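/- arXiv:1909.10131 — 3 statements merged into one kernel-verified Lean document; each statement's English description precedes it below -/
import Mathlib

section
/- Let n ≥ 3 be an integer and let ψ be a nonconstant standard radial factor with period T. Then: (i) there exist smooth T-periodic functions p₀⁺, p₀⁻ : ℝ → ℝ and a constant a such that the functions t ↦ p₀⁺(t) and t ↦ a t p₀⁺(t) + p₀⁻(t) are linearly independent solutions of η'' + ( (n(n+2)/4) ψ^{4/(n−2)} − (n−2)²/4 ) η = 0 on ℝ, and every solution is a linear combination of them; (ii) there exists a strictly increasing sequence of positive real numbers (ρ_d)_{d≥1} with ρ_d → ∞ and ρ_1 = 1 such that for each integer d ≥ 1 there are smooth T-periodic functions p_d⁺, p_d⁻ : ℝ → ℝ for which t ↦ e^{−ρ_d t} p_d⁺(t) and t ↦ e^{ρ_d t} p_d⁻(t) are linearly independent solutions of η'' + ( (n(n+2)/4) ψ^{4/(n−2)} − (n−2)²/4 − d(d+n−2) ) η = 0 on ℝ, and every solution is a linear combination of them. -/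
open scoped Topology ENNReal
open Metric Filter MeasureTheory

noncomputable section

abbrev E (n : ℕ) := EuclideanSpace ℝ (Fin n)

/-- Euclidean Laplacian via second iterated derivative in coordinate directions. -/
def lap (n : ℕ) (u : E n → ℝ) (x : E n) : ℝ :=
  ∑ i : Fin n, iteratedFDeriv ℝ 2 u x (fun _ => EuclideanSpace.single i 1)

/-- The Yamabe operator `M(u) = Δu + (n(n−2)/4) u^{(n+2)/(n−2)}`. -/
def yamabeOp (n : ℕ) (u : E n → ℝ) (x : E n) : ℝ :=
  lap n u x + ((n : ℝ) * ((n : ℝ) - 2)) / 4 * u x ^ (((n : ℝ) + 2) / ((n : ℝ) - 2))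

/-- A standard radial factor: smooth, positive, `< 1`, `T`-periodic solution of the
radial Yamabe ODE in cylindrical coordinates. -/
def IsStdRadial (n : ℕ) (ψ : ℝ → ℝ) (T : ℝ) : Prop :=
  ContDiff ℝ (⊤ : ℕ∞) ψ ∧ 0 < T ∧ Function.Periodic ψ T ∧ (∀ t, 0 < ψ t ∧ ψ t < 1) ∧
    ∀ t, deriv (deriv ψ) t - ((n : ℝ) - 2) ^ 2 / 4 * ψ t
        + ((n : ℝ) * ((n : ℝ) - 2)) / 4 * ψ t ^ (((n : ℝ) + 2) / ((n : ℝ) - 2)) = 0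

/-- The operator `L_{ψ,d}` acting on functions of `t ∈ ℝ`. -/
def odeOp (n : ℕ) (ψ : ℝ → ℝ) (d : ℕ) (η : ℝ → ℝ) (t : ℝ) : ℝ :=
  deriv (deriv η) t
    + (((n : ℝ) * ((n : ℝ) + 2)) / 4 * ψ t ^ ((4 : ℝ) / ((n : ℝ) - 2))
        - ((n : ℝ) - 2) ^ 2 / 4 - (d : ℝ) * ((d : ℝ) + (n : ℝ) - 2)) * η t

/-- `ρ` is the indicial root of degree `d`. -/
def IsIndicialRoot (n : ℕ) (ψ : ℝ → ℝ) (T : ℝ) (d : ℕ) (ρ : ℝ) : Prop :=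
  0 < ρ ∧ ∃ p : ℝ → ℝ, (∃ t, p t ≠ 0) ∧ Function.Periodic p T ∧
    ∀ t, odeOp n ψ d (fun s => Real.exp (-ρ * s) * p s) t = 0

/-- The index set `I(ψ)`. -/
def IndexSet (ρ : ℕ → ℝ) : Set ℝ :=
  { μ | ∃ D : ℕ, 1 ≤ D ∧ ∃ m : ℕ → ℕ,
      (∃ d, 1 ≤ d ∧ d ≤ D ∧ m d ≠ 0) ∧
      μ = ∑ d ∈ Finset.Icc 1 D, (m d : ℝ) * ρ d }

/-- The linearized Yamabe operator at `û_ψ`. -/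
def linYamabe (n : ℕ) (ψ : ℝ → ℝ) (W : E n → ℝ) (x : E n) : ℝ :=
  lap n W x + ((n : ℝ) * ((n : ℝ) + 2)) / 4 * ‖x‖ ^ (-2 : ℝ)
      * ψ (-Real.log ‖x‖) ^ ((4 : ℝ) / ((n : ℝ) - 2)) * W x

/-- Picard iterates. -/
def picIter {F : Type*} [NormedAddCommGroup F] [NormedSpace ℝ F] (A : ℝ → F →L[ℝ] F) (x0 : F) :
    ℕ → ℝ → F
  | 0 => fun _ => x0
  | (k+1) => fun t => ∫ s in (0:ℝ)..t, A s (picIter A x0 k s)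

lemma picIter_cont {F : Type*} [NormedAddCommGroup F] [NormedSpace ℝ F] [CompleteSpace F]
    (A : ℝ → F →L[ℝ] F) (hA : Continuous A) (x0 : F) (k : ℕ) : Continuous (picIter A x0 k) := by
  induction k with
  | zero => exact continuous_const
  | succ k ih =>
    have h : Continuous fun s => A s (picIter A x0 k s) := hA.clm_apply ih
    exact intervalIntegral.continuous_primitive (fun a b => h.intervalIntegrable a b) 0

lemma picIter_deriv {F : Type*} [NormedAddCommGroup F] [NormedSpace ℝ F] [CompleteSpace F]
    (A : ℝ → F →L[ℝ] F) (hA : Continuous A) (x0 : F) (k : ℕ) (t : ℝ) :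
    HasDerivAt (picIter A x0 (k+1)) (A t (picIter A x0 k t)) t := by
  have h : Continuous fun s => A s (picIter A x0 k s) := hA.clm_apply (picIter_cont A hA x0 k)
  exact intervalIntegral.integral_hasDerivAt_right (h.intervalIntegrable 0 t)
    (h.stronglyMeasurableAtFilter _ _) h.continuousAt

lemma picIter_bound {F : Type*} [NormedAddCommGroup F] [NormedSpace ℝ F] [CompleteSpace F]
    (A : ℝ → F →L[ℝ] F) (hA : Continuous A) (K : ℝ) (hK : 0 < K) (hAK : ∀ t, ‖A t‖ ≤ K)
    (x0 : F) (k : ℕ) (t : ℝ) :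
    ‖picIter A x0 k t‖ ≤ ‖x0‖ * (1/2)^k * Real.cosh (2 * K * t) := by
  induction k generalizing t with
  | zero =>
    simp only [picIter, pow_zero, mul_one]
    exact le_mul_of_one_le_right (norm_nonneg _) (Real.one_le_cosh _)
  | succ k ih =>
    have hd : ∀ s : ℝ, HasDerivAt (fun s => ‖x0‖ * (1/2)^(k+1) * Real.sinh (2*K*s))
        (K * (‖x0‖ * (1/2)^k * Real.cosh (2 * K * s))) s := by
      intro s
      have h1 : HasDerivAt (fun s : ℝ => 2*K*s) (2*K) s := by
        simpa using (hasDerivAt_id s).const_mul (2*K)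
      have := (h1.sinh).const_mul (‖x0‖ * (1/2)^(k+1))
      exact this.congr_deriv (by rw [pow_succ]; ring)
    have hc : Continuous fun s : ℝ => K * (‖x0‖ * (1/2)^k * Real.cosh (2 * K * s)) := by
      have := Real.continuous_cosh
      fun_prop
    have hi := intervalIntegral.integral_eq_sub_of_hasDerivAt (a := 0) (b := t)
      (fun s _ => hd s) (hc.intervalIntegrable 0 t)
    have hb : ‖∫ s in (0:ℝ)..t, A s (picIter A x0 k s)‖ ≤
        |∫ s in (0:ℝ)..t, K * (‖x0‖ * (1/2)^k * Real.cosh (2 * K * s))| := by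
      apply intervalIntegral.norm_integral_le_abs_of_norm_le
      · refine Eventually.of_forall fun s => ?_
        exact ((A s).le_opNorm _).trans
          (mul_le_mul (hAK s) (ih s) (norm_nonneg _) hK.le)
      · exact hc.intervalIntegrable 0 t
    rw [hi] at hb
    refine hb.trans ?_
    simp only [mul_zero, Real.sinh_zero, sub_zero]
    rw [abs_mul, abs_of_nonneg (by positivity : 0 ≤ ‖x0‖ * (1/2)^(k+1))]
    gcongr
    rw [Real.abs_sinh, ← Real.cosh_abs]
    exact (Real.sinh_lt_cosh _).le

lemma linear_ode_exists {F : Type*} [NormedAddCommGroup F] [NormedSpace ℝ F] [CompleteSpace F]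
    (A : ℝ → F →L[ℝ] F) (hA : Continuous A) (K : ℝ) (hK : 0 < K) (hAK : ∀ t, ‖A t‖ ≤ K)
    (x0 : F) : ∃ x : ℝ → F, x 0 = x0 ∧ ∀ t, HasDerivAt x (A t (x t)) t := by
  have hsum : ∀ t, Summable fun k => picIter A x0 k t := by
    intro t
    refine Summable.of_norm_bounded (g := fun k => ‖x0‖ * (1/2)^k * Real.cosh (2 * K * t)) ?_
      (fun k => picIter_bound A hA K hK hAK x0 k t)
    exact ((summable_geometric_two).mul_left _).mul_right _
  refine ⟨fun t => ∑' k, picIter A x0 k t, ?_, ?_⟩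
  · change ∑' k, picIter A x0 k 0 = x0
    rw [tsum_eq_single 0]
    · rfl
    · intro k hk
      obtain ⟨j, rfl⟩ := Nat.exists_eq_succ_of_ne_zero hk
      simp [picIter]
  · intro t
    have hs1 : ∀ t, Summable fun k => picIter A x0 (k+1) t := fun t =>
      (summable_nat_add_iff 1).2 (hsum t)
    have key : HasDerivAt (fun z => ∑' k, picIter A x0 (k+1) z)
        (∑' k, A t (picIter A x0 k t)) t := by
      apply hasDerivAt_tsum_of_isPreconnected (t := Metric.ball (0:ℝ) (|t|+1)) (y₀ := 0)
        (u := fun k => K * (‖x0‖ * (1/2)^k * Real.cosh (2 * K * (|t|+1))))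
        (g := fun k z => picIter A x0 (k+1) z) (g' := fun k z => A z (picIter A x0 k z))
      · exact (((summable_geometric_two).mul_left _).mul_right _).mul_left _
      · exact isOpen_ball
      · exact (convex_ball (0:ℝ) (|t|+1)).isPreconnected
      · intro k y _
        exact picIter_deriv A hA x0 k y
      · intro k y hy
        refine ((A y).le_opNorm _).trans (mul_le_mul (hAK y)
          ((picIter_bound A hA K hK hAK x0 k y).trans ?_) (norm_nonneg _) hK.le)
        gcongr
        rw [Real.cosh_le_cosh, abs_mul (2*K), abs_mul (2*K), abs_of_pos (by positivity : (0:ℝ) < 2 * K),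
          abs_of_pos (by positivity : (0:ℝ) < |t| + 1)]
        have : |y| < |t| + 1 := by simpa using hy
        gcongr
      · simp; positivity
      · exact hs1 0
      · simp
    have e1 : (fun z => ∑' k, picIter A x0 k z) = fun z => x0 + ∑' k, picIter A x0 (k+1) z := by
      funext z
      rw [(hsum z).tsum_eq_zero_add]
      rfl
    rw [e1]
    have := key.const_add x0
    convert this using 1
    rw [← (A t).map_tsum (hsum t), (hsum t).tsum_eq_zero_add]
    rfl

/-- Scalar second order linear ODE: existence of smooth solutions. -/
lemma hill_exists (Q : ℝ → ℝ) (hQ : ContDiff ℝ (⊤ : ℕ∞) Q) (K : ℝ) (hQK : ∀ t, |Q t| ≤ K)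
    (a b : ℝ) : ∃ η : ℝ → ℝ, ContDiff ℝ (⊤ : ℕ∞) η ∧ η 0 = a ∧ deriv η 0 = b ∧
      ∀ t, deriv (deriv η) t = Q t * η t := by
  let A : ℝ → (ℝ × ℝ) →L[ℝ] (ℝ × ℝ) := fun t =>
    (ContinuousLinearMap.snd ℝ ℝ ℝ).prod (Q t • ContinuousLinearMap.fst ℝ ℝ ℝ)
  have hAap : ∀ t x, A t x = (x.2, Q t * x.1) := by intro t x; simp [A]
  have hA : Continuous A := by
    have hQc := hQ.continuous
    have e : A = fun t => (ContinuousLinearMap.inl ℝ ℝ ℝ).comp (ContinuousLinearMap.snd ℝ ℝ ℝ)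
        + Q t • (ContinuousLinearMap.inr ℝ ℝ ℝ).comp (ContinuousLinearMap.fst ℝ ℝ ℝ) := by
      funext t
      ext <;> simp [A]
    rw [e]
    fun_prop
  have hAK : ∀ t, ‖A t‖ ≤ max 1 K := by
    intro t
    refine ContinuousLinearMap.opNorm_le_bound _ (by positivity) fun x => ?_
    rw [hAap, Prod.norm_def]
    have h1 := norm_fst_le x
    have h2 := norm_snd_le x
    apply max_le
    · calc ‖x.2‖ ≤ 1 * ‖x‖ := by simpa using h2
        _ ≤ _ := by gcongr; exact le_max_left _ _
    · rw [norm_mul]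
      gcongr
      exact (hQK t).trans (le_max_right _ _)
  obtain ⟨x, hx0, hx⟩ := linear_ode_exists A hA (max 1 K) (by positivity) hAK (a, b)
  have h1 : ∀ t, HasDerivAt (fun t => (x t).1) (x t).2 t := by
    intro t
    have := (ContinuousLinearMap.fst ℝ ℝ ℝ).hasFDerivAt.comp_hasDerivAt t (hx t)
    rw [hAap] at this
    exact this
  have h2 : ∀ t, HasDerivAt (fun t => (x t).2) (Q t * (x t).1) t := by
    intro t
    have := (ContinuousLinearMap.snd ℝ ℝ ℝ).hasFDerivAt.comp_hasDerivAt t (hx t)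
    rw [hAap] at this
    exact this
  have d1 : deriv (fun t => (x t).1) = fun t => (x t).2 := funext fun t => (h1 t).deriv
  have d2 : deriv (fun t => (x t).2) = fun t => Q t * (x t).1 := funext fun t => (h2 t).deriv
  have hsm : ∀ k : ℕ, ContDiff ℝ k (fun t => (x t).1) ∧ ContDiff ℝ k (fun t => (x t).2) := by
    intro k
    induction k with
    | zero =>
      simp only [Nat.cast_zero, contDiff_zero]
      exact ⟨continuous_iff_continuousAt.2 fun t => (h1 t).continuousAt,
        continuous_iff_continuousAt.2 fun t => (h2 t).continuousAt⟩
    | succ k ih =>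
      push_cast
      rw [contDiff_succ_iff_deriv, contDiff_succ_iff_deriv, d1, d2]
      refine ⟨⟨fun t => (h1 t).differentiableAt, by simp, ih.2⟩,
        ⟨fun t => (h2 t).differentiableAt, by simp, ?_⟩⟩
      exact (hQ.of_le (by exact_mod_cast le_top)).mul ih.1
  refine ⟨fun t => (x t).1, contDiff_infty.2 fun k => (hsm k).1, by simp [hx0], ?_, ?_⟩
  · rw [d1]; simp [hx0]
  · intro t; rw [d1, d2]

lemma pos_aux (Q h h1 h2 : ℝ → ℝ) (hQ0 : ∀ t, 0 ≤ Q t)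
    (hd : ∀ t, HasDerivAt h (h1 t) t) (hd1 : ∀ t, HasDerivAt h1 (h2 t) t)
    (hode : ∀ t, 0 ≤ t → Q t * h t ≤ h2 t) (h0 : 0 < h 0) (h10 : 0 ≤ h1 0) :
    ∀ t, 0 ≤ t → 0 ≤ h t ∧ 0 ≤ h1 t := by
  have hc : Continuous h := continuous_iff_continuousAt.2 fun t => (hd t).continuousAt
  have hc1 : Continuous h1 := continuous_iff_continuousAt.2 fun t => (hd1 t).continuousAt
  -- step: if `h ≥ 0` on `[0,t0)` then `h1 ≥ 0` on `[0,t0]` and `h t0 ≥ h 0`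
  have step : ∀ t0, 0 ≤ t0 → (∀ t, 0 ≤ t → t < t0 → 0 ≤ h t) → 0 ≤ h1 t0 ∧ h 0 ≤ h t0 := by
    intro t0 ht0 hpos
    have m1 : MonotoneOn h1 (Set.Icc 0 t0) := by
      apply monotoneOn_of_deriv_nonneg (convex_Icc 0 t0) hc1.continuousOn
      · exact fun t _ => (hd1 t).differentiableAt.differentiableWithinAt
      · intro t ht
        rw [interior_Icc] at ht
        rw [(hd1 t).deriv]
        exact (mul_nonneg (hQ0 t) (hpos t ht.1.le ht.2)).trans (hode t ht.1.le)
    have p1 : ∀ t ∈ Set.Icc 0 t0, 0 ≤ h1 t := fun t ht =>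
      h10.trans (m1 ⟨le_rfl, ht0⟩ ht ht.1)
    have m0 : MonotoneOn h (Set.Icc 0 t0) := by
      apply monotoneOn_of_deriv_nonneg (convex_Icc 0 t0) hc.continuousOn
      · exact fun t _ => (hd t).differentiableAt.differentiableWithinAt
      · intro t ht
        rw [(hd t).deriv]
        exact p1 t (interior_subset ht)
    exact ⟨p1 t0 ⟨ht0, le_rfl⟩, m0 ⟨le_rfl, ht0⟩ ⟨ht0, le_rfl⟩ ht0⟩
  have hall : ∀ t, 0 ≤ t → 0 < h t := by
    by_contra hcon
    push Not at hcon
    obtain ⟨t1, ht1, hlt⟩ := hcon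
    let S : Set ℝ := {t | 0 ≤ t ∧ h t ≤ 0}
    have hSc : IsClosed S :=
      (isClosed_le continuous_const continuous_id).inter (isClosed_le hc continuous_const)
    have hSb : BddBelow S := ⟨0, fun t ht => ht.1⟩
    have hm : sInf S ∈ S := hSc.csInf_mem ⟨t1, ht1, hlt⟩ hSb
    have := step (sInf S) hm.1 (fun t h0t htl => by
      by_contra hneg
      push Not at hneg
      exact absurd (csInf_le hSb (show t ∈ S from ⟨h0t, hneg.le⟩)) (not_le.2 htl))
    linarith [hm.2, this.2]
  intro t ht
  exact ⟨(hall t ht).le, (step t ht (fun s hs _ => (hall s hs).le)).1⟩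

lemma pos_lemma (Q g g1 g2 : ℝ → ℝ) (K : ℝ) (hQ0 : ∀ t, 0 ≤ Q t) (hQK : ∀ t, Q t ≤ K)
    (hd : ∀ t, HasDerivAt g (g1 t) t) (hd1 : ∀ t, HasDerivAt g1 (g2 t) t)
    (hode : ∀ t, 0 ≤ t → Q t * g t ≤ g2 t) (h0 : 0 ≤ g 0) (h10 : 0 ≤ g1 0) :
    ∀ t, 0 ≤ t → 0 ≤ g t ∧ 0 ≤ g1 t := by
  have hK0 : 0 ≤ K := (hQ0 0).trans (hQK 0)
  set L := K + 1 with hL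
  have hLQ : ∀ t, Q t ≤ L * L := fun t => (hQK t).trans (by nlinarith)
  have he : ∀ t, HasDerivAt (fun s => Real.exp (L * s)) (L * Real.exp (L * t)) t := by
    intro t
    have h1 : HasDerivAt (fun s : ℝ => L*s) L t := by
      simpa using (hasDerivAt_id t).const_mul L
    exact h1.exp.congr_deriv (by ring)
  have key : ∀ ε, 0 < ε → ∀ t, 0 ≤ t →
      0 ≤ g t + ε * Real.exp (L * t) ∧ 0 ≤ g1 t + ε * (L * Real.exp (L * t)) := by
    intro ε hε
    refine pos_aux Q (fun t => g t + ε * Real.exp (L * t))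
      (fun t => g1 t + ε * (L * Real.exp (L * t)))
      (fun t => g2 t + ε * (L * (L * Real.exp (L * t)))) hQ0
      (fun t => (hd t).add ((he t).const_mul ε))
      (fun t => (hd1 t).add (((he t).const_mul L).const_mul ε)) ?_ ?_ ?_
    · intro t ht
      have h1 := hode t ht
      have h2 : Q t * (ε * Real.exp (L*t)) ≤ L * L * (ε * Real.exp (L*t)) := by
        gcongr
        exact hLQ t
      nlinarith
    · simp; positivity
    · have : 0 < L := by positivity
      positivity
  intro t ht
  constructor
  · refine le_of_forall_pos_le_add fun δ hδ => ?_
    have := (key (δ / Real.exp (L*t)) (by positivity) t ht).1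
    rwa [div_mul_cancel₀ _ (Real.exp_pos _).ne'] at this
  · refine le_of_forall_pos_le_add fun δ hδ => ?_
    have hLp : 0 < L := by positivity
    have := (key (δ / (L * Real.exp (L*t))) (by positivity) t ht).2
    rwa [div_mul_cancel₀ _ (by positivity)] at this

/-- Solutions of `η'' = Q η`. -/
structure Sol (Q η : ℝ → ℝ) : Prop where
  d0 : Differentiable ℝ η
  d1 : Differentiable ℝ (deriv η)
  eq : ∀ t, deriv (deriv η) t = Q t * η t

lemma Sol.of_contDiff {Q η : ℝ → ℝ} (h : ContDiff ℝ 2 η)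
    (he : ∀ t, deriv (deriv η) t = Q t * η t) : Sol Q η := by
  rw [show (2 : WithTop ℕ∞) = 1 + 1 by norm_num, contDiff_succ_iff_deriv] at h
  exact ⟨h.1, h.2.2.differentiable (by norm_num), he⟩

lemma Sol.h0 {Q η : ℝ → ℝ} (h : Sol Q η) (t : ℝ) : HasDerivAt η (deriv η t) t :=
  (h.d0 t).hasDerivAt

lemma Sol.h1 {Q η : ℝ → ℝ} (h : Sol Q η) (t : ℝ) : HasDerivAt (deriv η) (Q t * η t) t := by
  rw [← h.eq]; exact (h.d1 t).hasDerivAt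

lemma Sol.mk' {Q η η1 : ℝ → ℝ} (h0 : ∀ t, HasDerivAt η (η1 t) t)
    (h1 : ∀ t, HasDerivAt η1 (Q t * η t) t) : Sol Q η := by
  have e : deriv η = η1 := funext fun t => (h0 t).deriv
  refine ⟨fun t => (h0 t).differentiableAt, ?_, ?_⟩
  · rw [e]; exact fun t => (h1 t).differentiableAt
  · rw [e]; exact fun t => (h1 t).deriv

/-- Wronskian. -/
def wr (u v : ℝ → ℝ) (t : ℝ) : ℝ := u t * deriv v t - deriv u t * v t

lemma wr_const {Q u v : ℝ → ℝ} (hu : Sol Q u) (hv : Sol Q v) (t s : ℝ) : wr u v t = wr u v s := by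
  have hd : ∀ t, HasDerivAt (wr u v) 0 t := by
    intro t
    have := ((hu.h0 t).mul (hv.h1 t)).sub ((hu.h1 t).mul (hv.h0 t))
    exact this.congr_deriv (by ring)
  exact is_const_of_deriv_eq_zero (fun t => (hd t).differentiableAt) (fun t => (hd t).deriv) t s

lemma sol_span {Q u v η : ℝ → ℝ} (hu : Sol Q u) (hv : Sol Q v) (hη : Sol Q η)
    (hw : wr u v 0 ≠ 0) (t : ℝ) :
    η t = (wr η v 0 / wr u v 0) * u t + (wr u η 0 / wr u v 0) * v t := by
  rw [div_mul_eq_mul_div, div_mul_eq_mul_div, ← add_div, eq_div_iff hw]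
  rw [wr_const hu hv 0 t, wr_const hη hv 0 t, wr_const hu hη 0 t]
  unfold wr
  ring

lemma sol_indep {u v : ℝ → ℝ} (hu : Differentiable ℝ u) (hv : Differentiable ℝ v) (t : ℝ)
    (hw : wr u v t ≠ 0) : LinearIndependent ℝ ![u, v] := by
  rw [LinearIndependent.pair_iff]
  intro a b hab
  have h0 : ∀ s, a * u s + b * v s = 0 := fun s => by
    have := congrFun hab s
    simpa using this
  have h1 : a * deriv u t + b * deriv v t = 0 := by
    have hd := ((hu t).hasDerivAt.const_mul a).add ((hv t).hasDerivAt.const_mul b)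
    have e : (fun s => a * u s + b * v s) = fun _ => 0 := funext h0
    have hd' : HasDerivAt (fun s => a * u s + b * v s)
      (a * deriv u t + b * deriv v t) t := hd
    rw [e] at hd'
    exact hd'.unique (hasDerivAt_const t 0)
  have h0t := h0 t
  constructor
  · have : a * wr u v t = 0 := by unfold wr; linear_combination deriv v t * h0t - v t * h1
    exact (mul_eq_zero.1 this).resolve_right hw
  · have : b * wr u v t = 0 := by unfold wr; linear_combination u t * h1 - deriv u t * h0t
    exact (mul_eq_zero.1 this).resolve_right hw

lemma Sol.lin {Q u v : ℝ → ℝ} (hu : Sol Q u) (hv : Sol Q v) (a b : ℝ) :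
    Sol Q (fun t => a * u t + b * v t) :=
  Sol.mk' (η1 := fun t => a * deriv u t + b * deriv v t)
    (fun t => ((hu.h0 t).const_mul a).add ((hv.h0 t).const_mul b))
    (fun t => (((hu.h1 t).const_mul a).add ((hv.h1 t).const_mul b)).congr_deriv (by ring))

lemma Sol.shift {Q u : ℝ → ℝ} {T : ℝ} (hQ : Function.Periodic Q T) (hu : Sol Q u) :
    Sol Q (fun t => u (t + T)) :=
  Sol.mk' (η1 := fun t => deriv u (t + T))
    (fun t => (hu.h0 (t+T)).comp_add_const t T)
    (fun t => ((hu.h1 (t+T)).comp_add_const t T).congr_deriv (by rw [hQ t]))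

lemma sol_rep {Q c s η : ℝ → ℝ} (hc : Sol Q c) (hs : Sol Q s) (c0 : c 0 = 1) (c1 : deriv c 0 = 0)
    (s0 : s 0 = 0) (s1 : deriv s 0 = 1) (hη : Sol Q η) (t : ℝ) :
    η t = η 0 * c t + deriv η 0 * s t := by
  have hw : wr c s 0 = 1 := by simp [wr, c0, c1, s0, s1]
  have := sol_span hc hs hη (by rw [hw]; norm_num) t
  rw [this, hw]
  simp [wr, c0, c1, s0, s1]

lemma sol_rep_shift {Q c s η : ℝ → ℝ} {T : ℝ} (hQ : Function.Periodic Q T)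
    (hc : Sol Q c) (hs : Sol Q s) (c0 : c 0 = 1) (c1 : deriv c 0 = 0)
    (s0 : s 0 = 0) (s1 : deriv s 0 = 1) (hη : Sol Q η) (t : ℝ) :
    η (t + T) = η T * c t + deriv η T * s t := by
  have := sol_rep hc hs c0 c1 s0 s1 (hη.shift hQ) t
  rw [this]
  have e : deriv (fun t => η (t + T)) 0 = deriv η T := by
    rw [deriv_comp_add_const]; simp
  rw [e]; simp

lemma flo_aux {Q c s : ℝ → ℝ} {T : ℝ} (hQ : Function.Periodic Q T)
    (hc : Sol Q c) (hs : Sol Q s) (c0 : c 0 = 1) (c1 : deriv c 0 = 0)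
    (s0 : s 0 = 0) (s1 : deriv s 0 = 1)
    (hcs : ContDiff ℝ (⊤ : ℕ∞) c) (hss : ContDiff ℝ (⊤ : ℕ∞) s) (r : ℝ)
    (hr : Real.exp (r * T) + Real.exp (-(r * T)) = c T + deriv s T) :
    ∃ p : ℝ → ℝ, ContDiff ℝ (⊤ : ℕ∞) p ∧ Function.Periodic p T ∧
      (fun t => Real.exp (r * t) * p t) = fun t => s T * c t + (Real.exp (r * T) - c T) * s t := by
  have hdet : c T * deriv s T - deriv c T * s T = 1 := by
    have := wr_const hc hs T 0
    simpa [wr, c0, c1, s0, s1] using this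
  have hmm : Real.exp (r * T) * Real.exp (-(r * T)) = 1 := by
    rw [← Real.exp_add]; simp
  refine ⟨fun t => Real.exp (-(r * t)) * (s T * c t + (Real.exp (r * T) - c T) * s t), ?_, ?_, ?_⟩
  · have : ContDiff ℝ (⊤ : ℕ∞) (fun t : ℝ => Real.exp (-(r * t))) := by fun_prop
    exact this.mul ((contDiff_const.mul hcs).add (contDiff_const.mul hss))
  · intro t
    have e1 := sol_rep_shift hQ hc hs c0 c1 s0 s1 hc t
    have e2 := sol_rep_shift hQ hc hs c0 c1 s0 s1 hs t
    have e3 : Real.exp (-(r * (t + T))) = Real.exp (-(r*t)) * Real.exp (-(r * T)) := by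
      rw [← Real.exp_add]; congr 1; ring
    simp only [e1, e2, e3]
    set μ := Real.exp (r * T)
    set ν := Real.exp (-(r * T))
    have hs' : deriv s T = μ + ν - c T := by linarith
    rw [hs'] at hdet ⊢
    have : ν * (s T * (c T * c t + deriv c T * s t) + (μ - c T) * (s T * c t + (μ + ν - c T) * s t))
        = s T * c t + (μ - c T) * s t := by
      linear_combination (s T * c t + s t * μ - s t * c T) * hmm - ν * s t * hdet + ν * s t * hmm
    rw [mul_assoc, this]
  · funext t
    rw [← mul_assoc, ← Real.exp_add]
    simp

/-- Floquet package. -/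
def Pack (Q : ℝ → ℝ) (T ρ : ℝ) : Prop :=
  ∃ pdp pdm : ℝ → ℝ, ContDiff ℝ (⊤ : ℕ∞) pdp ∧ ContDiff ℝ (⊤ : ℕ∞) pdm ∧
    Function.Periodic pdp T ∧ Function.Periodic pdm T ∧
    Sol Q (fun s => Real.exp (-ρ * s) * pdp s) ∧ Sol Q (fun s => Real.exp (ρ * s) * pdm s) ∧
    ∃ t, wr (fun s => Real.exp (-ρ * s) * pdp s) (fun s => Real.exp (ρ * s) * pdm s) t ≠ 0

/-- Normalized fundamental system. -/
structure Fund (Q c s : ℝ → ℝ) : Prop where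
  hc : Sol Q c
  hs : Sol Q s
  c0 : c 0 = 1
  c1 : deriv c 0 = 0
  s0 : s 0 = 0
  s1 : deriv s 0 = 1
  hcs : ContDiff ℝ (⊤ : ℕ∞) c
  hss : ContDiff ℝ (⊤ : ℕ∞) s

lemma fund_exists (Q : ℝ → ℝ) (hQ : ContDiff ℝ (⊤ : ℕ∞) Q) (K : ℝ) (hQK : ∀ t, |Q t| ≤ K) :
    ∃ c s, Fund Q c s := by
  obtain ⟨c, hc, c0, c1, ce⟩ := hill_exists Q hQ K hQK 1 0
  obtain ⟨s, hs, s0, s1, se⟩ := hill_exists Q hQ K hQK 0 1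
  exact ⟨c, s, Sol.of_contDiff (by exact_mod_cast contDiff_infty.1 hc 2) ce,
    Sol.of_contDiff (by exact_mod_cast contDiff_infty.1 hs 2) se, c0, c1, s0, s1, hc, hs⟩

lemma pack_of_trace {Q c s : ℝ → ℝ} {T ρ : ℝ} (hQ : Function.Periodic Q T) (F : Fund Q c s)
    (hT : 0 < T) (hρ : 0 < ρ) (hsT : s T ≠ 0)
    (htr : c T + deriv s T = 2 * Real.cosh (ρ * T)) : Pack Q T ρ := by
  have h1 : Real.exp (ρ * T) + Real.exp (-(ρ * T)) = c T + deriv s T := by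
    rw [htr, Real.cosh_eq]; ring
  have h2 : Real.exp (-ρ * T) + Real.exp (-(-ρ * T)) = c T + deriv s T := by
    rw [← h1]; simp [add_comm]
  obtain ⟨pm, hpm, hpmp, em⟩ := flo_aux hQ F.hc F.hs F.c0 F.c1 F.s0 F.s1 F.hcs F.hss ρ h1
  obtain ⟨pp, hpp, hppp, ep⟩ := flo_aux hQ F.hc F.hs F.c0 F.c1 F.s0 F.s1 F.hcs F.hss (-ρ) h2
  refine ⟨pp, pm, hpp, hpm, hppp, hpmp, ?_, ?_, 0, ?_⟩
  · rw [ep]; exact F.hc.lin F.hs _ _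
  · rw [em]; exact F.hc.lin F.hs _ _
  · rw [ep, em]
    have hder : ∀ a b : ℝ, deriv (fun t => a * c t + b * s t) 0 = b := by
      intro a b
      have := ((F.hc.h0 0).const_mul a).add ((F.hs.h0 0).const_mul b)
      rw [F.c1, F.s1] at this
      have h := this.deriv
      simp only [mul_zero, zero_add, mul_one] at h
      exact h
    unfold wr
    rw [hder, hder]
    simp only [F.c0, F.s0]
    have hlt : Real.exp (-ρ * T) < Real.exp (ρ * T) := by
      apply Real.exp_lt_exp.2
      nlinarith [mul_pos hρ hT]
    have : s T * (Real.exp (ρ * T) - Real.exp (-ρ * T)) ≠ 0 := mul_ne_zero hsT (by linarith)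
    intro h
    apply this
    linarith

lemma hasDerivAt_cosh_mul (k t : ℝ) :
    HasDerivAt (fun t => Real.cosh (k * t)) (k * Real.sinh (k * t)) t := by
  have h1 : HasDerivAt (fun s : ℝ => k*s) k t := by simpa using (hasDerivAt_id t).const_mul k
  exact h1.cosh.congr_deriv (by ring)

lemma hasDerivAt_sinh_mul (k t : ℝ) :
    HasDerivAt (fun t => Real.sinh (k * t)) (k * Real.cosh (k * t)) t := by
  have h1 : HasDerivAt (fun s : ℝ => k*s) k t := by simpa using (hasDerivAt_id t).const_mul k
  exact h1.sinh.congr_deriv (by ring)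

lemma trace_lower {Q c s : ℝ → ℝ} {T k K : ℝ} (F : Fund Q c s) (hT : 0 < T) (hk : 0 < k)
    (hkQ : ∀ t, k ^ 2 ≤ Q t) (hQK : ∀ t, Q t ≤ K) :
    Real.cosh (k * T) ≤ c T ∧ Real.cosh (k * T) ≤ deriv s T ∧ 0 < s T := by
  have hQ0 : ∀ t, 0 ≤ Q t := fun t => (sq_nonneg k).trans (hkQ t)
  have A := pos_lemma Q (fun t => c t - Real.cosh (k * t))
    (fun t => deriv c t - k * Real.sinh (k * t))
    (fun t => Q t * c t - k * (k * Real.cosh (k * t))) K hQ0 hQK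
    (fun t => (F.hc.h0 t).sub (hasDerivAt_cosh_mul k t))
    (fun t => (F.hc.h1 t).sub ((hasDerivAt_sinh_mul k t).const_mul k))
    (fun t _ => by nlinarith [mul_le_mul_of_nonneg_right (hkQ t) (Real.cosh_pos (k * t)).le])
    (by simp [F.c0]) (by simp [F.c1]) T hT.le
  have B := pos_lemma Q (fun t => s t - k⁻¹ * Real.sinh (k * t))
    (fun t => deriv s t - Real.cosh (k * t))
    (fun t => Q t * s t - k * Real.sinh (k * t)) K hQ0 hQK
    (fun t => (F.hs.h0 t).sub (((hasDerivAt_sinh_mul k t).const_mul k⁻¹).congr_deriv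
      (by field_simp)))
    (fun t => (F.hs.h1 t).sub (hasDerivAt_cosh_mul k t))
    (fun t ht => by
      have h1 : 0 ≤ k⁻¹ * Real.sinh (k * t) :=
        mul_nonneg (by positivity) (Real.sinh_nonneg_iff.2 (by positivity))
      have h2 := mul_le_mul_of_nonneg_right (hkQ t) h1
      have h3 : k ^ 2 * (k⁻¹ * Real.sinh (k * t)) = k * Real.sinh (k * t) := by field_simp
      rw [h3] at h2
      linarith [mul_sub (Q t) (s t) (k⁻¹ * Real.sinh (k * t))])
    (by simp [F.s0]) (by simp [F.s1]) T hT.le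
  refine ⟨by linarith [A.1], by linarith [B.2], ?_⟩
  have : 0 < k⁻¹ * Real.sinh (k * T) :=
    mul_pos (by positivity) (Real.sinh_pos_iff.2 (by positivity))
  linarith [B.1]

lemma trace_mono {Q c s Q' c' s' : ℝ → ℝ} {T K δ : ℝ} (F : Fund Q c s) (F' : Fund Q' c' s')
    (hT : 0 < T) (hQ0 : ∀ t, 0 ≤ Q t) (hQK : ∀ t, Q' t ≤ K) (hδ : 0 < δ)
    (hQQ : ∀ t, Q' t = Q t + δ) : c T + deriv s T < c' T + deriv s' T := by
  have hQ0' : ∀ t, 0 ≤ Q' t := fun t => by rw [hQQ]; linarith [hQ0 t]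
  have hQK1 : ∀ t, Q t ≤ K := fun t => by linarith [hQK t, hQQ t]
  have C1 := pos_lemma Q (fun t => c t - 1) (fun t => deriv c t) (fun t => Q t * c t) K hQ0 hQK1
    (fun t => (F.hc.h0 t).sub_const 1) (fun t => F.hc.h1 t)
    (fun t _ => by nlinarith [hQ0 t]) (by simp [F.c0]) (by simp [F.c1])
  have S1 := pos_lemma Q s (fun t => deriv s t) (fun t => Q t * s t) K hQ0 hQK1
    (fun t => F.hs.h0 t) (fun t => F.hs.h1 t)
    (fun t _ => le_rfl) (by simp [F.s0]) (by simp [F.s1])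
  have A := pos_lemma Q' (fun t => c' t - c t - δ / 2 * t ^ 2)
    (fun t => deriv c' t - deriv c t - δ * t)
    (fun t => Q' t * c' t - Q t * c t - δ) K hQ0' hQK
    (fun t => by
      have h := ((hasDerivAt_pow 2 t).const_mul (δ / 2))
      exact (((F'.hc.h0 t).sub (F.hc.h0 t)).sub h).congr_deriv (by simp; ring))
    (fun t => by
      have h := ((hasDerivAt_id t).const_mul δ)
      exact (((F'.hc.h1 t).sub (F.hc.h1 t)).sub h).congr_deriv (by simp))
    (fun t ht => by
      have h1 := (C1 t ht).1
      have h2 : 0 ≤ Q' t * (δ / 2 * t ^ 2) := mul_nonneg (hQ0' t) (by positivity)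
      have h3 : 0 ≤ δ * (c t - 1) := mul_nonneg hδ.le h1
      have h4 : Q' t * c t = Q t * c t + δ * c t := by rw [hQQ]; ring
      nlinarith)
    (by simp [F.c0, F'.c0]) (by simp [F.c1, F'.c1]) T hT.le
  have B := pos_lemma Q' (fun t => s' t - s t)
    (fun t => deriv s' t - deriv s t)
    (fun t => Q' t * s' t - Q t * s t) K hQ0' hQK
    (fun t => (F'.hs.h0 t).sub (F.hs.h0 t))
    (fun t => (F'.hs.h1 t).sub (F.hs.h1 t))
    (fun t ht => by
      have h1 := (S1 t ht).1
      have h3 : 0 ≤ δ * s t := mul_nonneg hδ.le h1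
      have h4 : Q' t * s t = Q t * s t + δ * s t := by rw [hQQ]; ring
      nlinarith)
    (by simp [F.s0, F'.s0]) (by simp [F.s1, F'.s1]) T hT.le
  have : 0 < δ / 2 * T ^ 2 := by positivity
  linarith [A.1, B.2]

/-- The potential. -/
def Qd (n : ℕ) (ψ : ℝ → ℝ) (d : ℕ) (t : ℝ) : ℝ :=
  (d : ℝ) * ((d : ℝ) + (n : ℝ) - 2) + ((n : ℝ) - 2) ^ 2 / 4
    - ((n : ℝ) * ((n : ℝ) + 2)) / 4 * ψ t ^ ((4 : ℝ) / ((n : ℝ) - 2))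

lemma odeOp_zero_iff (n : ℕ) (ψ : ℝ → ℝ) (d : ℕ) (η : ℝ → ℝ) (t : ℝ) :
    odeOp n ψ d η t = 0 ↔ deriv (deriv η) t = Qd n ψ d t * η t := by
  unfold odeOp Qd
  constructor <;> intro h <;> linarith

section
variable {n : ℕ} {ψ : ℝ → ℝ} {T : ℝ}

lemma n_ge (hn : 3 ≤ n) : (3 : ℝ) ≤ n := by exact_mod_cast hn

lemma Qd_smooth (hψ : IsStdRadial n ψ T) (d : ℕ) : ContDiff ℝ (⊤ : ℕ∞) (Qd n ψ d) := by
  have h : ContDiff ℝ (⊤ : ℕ∞) fun t => ψ t ^ ((4 : ℝ) / ((n : ℝ) - 2)) :=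
    hψ.1.rpow_const_of_ne fun t => (hψ.2.2.2.1 t).1.ne'
  exact contDiff_const.sub (contDiff_const.mul h)

lemma Qd_periodic (hψ : IsStdRadial n ψ T) (d : ℕ) : Function.Periodic (Qd n ψ d) T := by
  intro t
  simp only [Qd, hψ.2.2.1 t]

lemma psi_pow_bd (hn : 3 ≤ n) (hψ : IsStdRadial n ψ T) (t : ℝ) :
    0 < ψ t ^ ((4 : ℝ) / ((n : ℝ) - 2)) ∧ ψ t ^ ((4 : ℝ) / ((n : ℝ) - 2)) < 1 := by
  have hn' := n_ge hn
  obtain ⟨h0, h1⟩ := hψ.2.2.2.1 t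
  exact ⟨Real.rpow_pos_of_pos h0 _, Real.rpow_lt_one h0.le h1 (div_pos (by norm_num) (by linarith))⟩

lemma Qd_le (hψ : IsStdRadial n ψ T) (hn : 3 ≤ n) (d : ℕ) (t : ℝ) :
    Qd n ψ d t ≤ (d : ℝ) * ((d : ℝ) + (n : ℝ) - 2) + ((n : ℝ) - 2) ^ 2 / 4 := by
  have := psi_pow_bd hn hψ t
  have h : 0 ≤ ((n : ℝ) * ((n : ℝ) + 2)) / 4 * ψ t ^ ((4 : ℝ) / ((n : ℝ) - 2)) :=
    mul_nonneg (by positivity) this.1.le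
  unfold Qd
  linarith

lemma Qd_ge (hψ : IsStdRadial n ψ T) (hn : 3 ≤ n) (d : ℕ) (t : ℝ) :
    (d : ℝ) * ((d : ℝ) + (n : ℝ) - 2) - (3 * n - 2) / 2 ≤ Qd n ψ d t := by
  have := psi_pow_bd hn hψ t
  have h : ((n : ℝ) * ((n : ℝ) + 2)) / 4 * ψ t ^ ((4 : ℝ) / ((n : ℝ) - 2)) ≤
    ((n : ℝ) * ((n : ℝ) + 2)) / 4 * 1 := by
    gcongr
    exact this.2.le
  unfold Qd
  nlinarith

lemma Qd_ge_sq (hψ : IsStdRadial n ψ T) (hn : 3 ≤ n) (d : ℕ) (hd : 2 ≤ d) (t : ℝ) :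
    ((d : ℝ) - 1 / 2) ^ 2 ≤ Qd n ψ d t := by
  refine le_trans ?_ (Qd_ge hψ hn d t)
  have hn' := n_ge hn
  have hd' : (2 : ℝ) ≤ d := by exact_mod_cast hd
  nlinarith [mul_nonneg (sub_nonneg.2 hd') (by linarith : (0 : ℝ) ≤ (n : ℝ) - 1)]

lemma Qd_fund (hψ : IsStdRadial n ψ T) (hn : 3 ≤ n) (d : ℕ) : ∃ c s, Fund (Qd n ψ d) c s := by
  refine fund_exists _ (Qd_smooth hψ d) (max ((d : ℝ) * ((d : ℝ) + (n : ℝ) - 2) + ((n : ℝ) - 2) ^ 2 / 4)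
    (-((d : ℝ) * ((d : ℝ) + (n : ℝ) - 2) - (3 * n - 2) / 2))) fun t => ?_
  rw [abs_le]
  constructor
  · have h1 := le_max_right ((d : ℝ) * ((d : ℝ) + (n : ℝ) - 2) + ((n : ℝ) - 2) ^ 2 / 4)
      (-((d : ℝ) * ((d : ℝ) + (n : ℝ) - 2) - (3 * n - 2) / 2))
    linarith [Qd_ge hψ hn d t]
  · exact (Qd_le hψ hn d t).trans (le_max_left _ _)

lemma psi_h0 (hψ : IsStdRadial n ψ T) (t : ℝ) : HasDerivAt ψ (deriv ψ t) t :=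
  (hψ.1.differentiable (by simp) t).hasDerivAt

lemma psi1_smooth (hψ : IsStdRadial n ψ T) : ContDiff ℝ (⊤ : ℕ∞) (deriv ψ) :=
  (contDiff_infty_iff_deriv.1 hψ.1).2

lemma psi_rpow (hn : 3 ≤ n) (hψ : IsStdRadial n ψ T) (t : ℝ) :
    ψ t ^ (((n : ℝ) + 2) / ((n : ℝ) - 2)) = ψ t * ψ t ^ ((4 : ℝ) / ((n : ℝ) - 2)) := by
  have hn' := n_ge hn
  have : ((n : ℝ) + 2) / ((n : ℝ) - 2) = 1 + (4 : ℝ) / ((n : ℝ) - 2) := by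
    have : (n : ℝ) - 2 ≠ 0 := by linarith
    field_simp
    ring
  rw [this, Real.rpow_add (hψ.2.2.2.1 t).1, Real.rpow_one]

lemma psi2_eq (hn : 3 ≤ n) (hψ : IsStdRadial n ψ T) (t : ℝ) :
    deriv (deriv ψ) t = ((n : ℝ) - 2) ^ 2 / 4 * ψ t
      - ((n : ℝ) * ((n : ℝ) - 2)) / 4 * (ψ t * ψ t ^ ((4 : ℝ) / ((n : ℝ) - 2))) := by
  have := hψ.2.2.2.2 t
  rw [psi_rpow hn hψ] at this
  linarith

lemma psi_h1 (hψ : IsStdRadial n ψ T) (t : ℝ) : HasDerivAt (deriv ψ) (deriv (deriv ψ) t) t :=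
  ((psi1_smooth hψ).differentiable (by simp) t).hasDerivAt

lemma psi_h2 (hn : 3 ≤ n) (hψ : IsStdRadial n ψ T) (t : ℝ) :
    HasDerivAt (deriv (deriv ψ)) (Qd n ψ 0 t * deriv ψ t) t := by
  have hn' := n_ge hn
  have hne : (n : ℝ) - 2 ≠ 0 := by linarith
  have e : deriv (deriv ψ) = fun t => ((n : ℝ) - 2) ^ 2 / 4 * ψ t
      - ((n : ℝ) * ((n : ℝ) - 2)) / 4 * ψ t ^ (((n : ℝ) + 2) / ((n : ℝ) - 2)) := by
    funext t
    linarith [hψ.2.2.2.2 t]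
  rw [e]
  have h := (psi_h0 hψ t).rpow_const (p := ((n : ℝ) + 2) / ((n : ℝ) - 2))
    (Or.inl (hψ.2.2.2.1 t).1.ne')
  have h' := ((psi_h0 hψ t).const_mul (((n : ℝ) - 2) ^ 2 / 4)).sub
    (h.const_mul (((n : ℝ) * ((n : ℝ) - 2)) / 4))
  refine h'.congr_deriv ?_
  have e2 : ((n : ℝ) + 2) / ((n : ℝ) - 2) - 1 = (4 : ℝ) / ((n : ℝ) - 2) := by
    field_simp
    ring
  rw [e2]
  unfold Qd
  set Y := ψ t ^ ((4 : ℝ) / ((n : ℝ) - 2))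
  simp only [Nat.cast_zero]
  field_simp
  ring

lemma sol_psi1 (hn : 3 ≤ n) (hψ : IsStdRadial n ψ T) : Sol (Qd n ψ 0) (deriv ψ) :=
  Sol.mk' (psi_h1 hψ) (psi_h2 hn hψ)

lemma Periodic_deriv {f : ℝ → ℝ} (hf : Function.Periodic f T) : Function.Periodic (deriv f) T := by
  intro t
  rw [← deriv_comp_add_const]
  congr 1
  exact funext hf

lemma sol_d1_aux (hn : 3 ≤ n) (hψ : IsStdRadial n ψ T) (ε : ℝ) (hε : ε * ε = 1) :
    (∀ t, HasDerivAt (fun t => Real.exp (ε * t) * (ε * deriv ψ t + ((n : ℝ) - 2) / 2 * ψ t))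
      (Real.exp (ε * t) * (deriv ψ t + ε * (((n : ℝ) - 2) / 2) * ψ t + ε * deriv (deriv ψ) t
        + ((n : ℝ) - 2) / 2 * deriv ψ t)) t) ∧
    Sol (Qd n ψ 1) (fun t => Real.exp (ε * t) * (ε * deriv ψ t + ((n : ℝ) - 2) / 2 * ψ t)) := by
  have he : ∀ t, HasDerivAt (fun s => Real.exp (ε * s)) (ε * Real.exp (ε * t)) t := by
    intro t
    have h1 : HasDerivAt (fun s : ℝ => ε*s) ε t := by
      simpa using (hasDerivAt_id t).const_mul ε
    exact h1.exp.congr_deriv (by ring)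
  have A : ∀ t, HasDerivAt (fun t => Real.exp (ε * t) * (ε * deriv ψ t + ((n : ℝ) - 2) / 2 * ψ t))
      (Real.exp (ε * t) * (deriv ψ t + ε * (((n : ℝ) - 2) / 2) * ψ t + ε * deriv (deriv ψ) t
        + ((n : ℝ) - 2) / 2 * deriv ψ t)) t := by
    intro t
    refine ((he t).mul (((psi_h1 hψ t).const_mul ε).add
      ((psi_h0 hψ t).const_mul (((n : ℝ) - 2) / 2)))).congr_deriv ?_
    simp only [Pi.add_apply]
    linear_combination Real.exp (ε * t) * deriv ψ t * hε
  refine ⟨A, Sol.mk' A fun t => ?_⟩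
  refine ((he t).mul ((((psi_h1 hψ t).add ((psi_h0 hψ t).const_mul (ε * (((n : ℝ) - 2) / 2)))).add
    ((psi_h2 hn hψ t).const_mul ε)).add
      ((psi_h1 hψ t).const_mul (((n : ℝ) - 2) / 2)))).congr_deriv ?_
  simp only [Pi.add_apply]
  rw [psi2_eq hn hψ t]
  unfold Qd
  set Y := ψ t ^ ((4 : ℝ) / ((n : ℝ) - 2))
  set N := (n : ℝ)
  set X := Real.exp (ε * t)
  push_cast
  linear_combination (X * (N - 2) / 2 * ψ t + X * ((N - 2) ^ 2 / 4 * ψ t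
      - (N * (N - 2)) / 4 * (ψ t * Y))) * hε

lemma pack_one (hn : 3 ≤ n) (hψ : IsStdRadial n ψ T) : Pack (Qd n ψ 1) T 1 := by
  have hn' := n_ge hn
  obtain ⟨A, SA⟩ := sol_d1_aux hn hψ (-1) (by norm_num)
  obtain ⟨B, SB⟩ := sol_d1_aux hn hψ 1 (by norm_num)
  have hsm : ∀ ε : ℝ, ContDiff ℝ (⊤ : ℕ∞) (fun t => ε * deriv ψ t + ((n : ℝ) - 2) / 2 * ψ t) :=
    fun ε => (contDiff_const.mul (psi1_smooth hψ)).add (contDiff_const.mul hψ.1)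
  have hper : ∀ ε : ℝ, Function.Periodic (fun t => ε * deriv ψ t + ((n : ℝ) - 2) / 2 * ψ t) T := by
    intro ε t
    simp only [hψ.2.2.1 t, Periodic_deriv hψ.2.2.1 t]
  refine ⟨_, _, hsm (-1), hsm 1, hper (-1), hper 1, SA, SB, ?_⟩
  obtain ⟨t, -, ht⟩ := exists_deriv_eq_zero (f := ψ) hψ.2.1 hψ.1.continuous.continuousOn
    (by simpa using (hψ.2.2.1 0).symm)
  refine ⟨t, ?_⟩
  unfold wr
  rw [(A t).deriv, (B t).deriv, ht, psi2_eq hn hψ t]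
  obtain ⟨h0, h1⟩ := psi_pow_bd hn hψ t
  have hp := (hψ.2.2.2.1 t).1
  set Y := ψ t ^ ((4 : ℝ) / ((n : ℝ) - 2))
  set N := (n : ℝ)
  have hee : Real.exp (-1 * t) * Real.exp (1 * t) = 1 := by
    rw [← Real.exp_add]; simp
  have key : 0 < (N - 2) * ψ t * ((N - 2) / 2 * (N / 2) * ψ t * (1 - Y)) := by
    have a1 : 0 < N - 2 := by linarith
    have a2 : 0 < N := by linarith
    have a3 : 0 < 1 - Y := by linarith
    positivity
  refine ne_of_gt (key.trans_eq ?_)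
  linear_combination (-((N - 2) * ψ t * ((N - 2) / 2 * (N / 2) * ψ t * (1 - Y)))) * hee

lemma part_one (hn : 3 ≤ n) (hψ : IsStdRadial n ψ T) (hnc : ∃ t s : ℝ, ψ t ≠ ψ s) :
    ∃ p₀p p₀m : ℝ → ℝ, ∃ a : ℝ,
      ContDiff ℝ (⊤ : ℕ∞) p₀p ∧ ContDiff ℝ (⊤ : ℕ∞) p₀m ∧
      Function.Periodic p₀p T ∧ Function.Periodic p₀m T ∧
      Sol (Qd n ψ 0) p₀p ∧ Sol (Qd n ψ 0) (fun s => a * s * p₀p s + p₀m s) ∧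
      wr p₀p (fun s => a * s * p₀p s + p₀m s) 0 ≠ 0 := by
  have hT := hψ.2.1
  set u := deriv ψ with hu
  have Su : Sol (Qd n ψ 0) u := sol_psi1 hn hψ
  have uper : Function.Periodic u T := Periodic_deriv hψ.2.2.1
  obtain ⟨c, s, F⟩ := Qd_fund hψ hn 0
  set v : ℝ → ℝ := fun t => (-deriv u 0) * c t + u 0 * s t with hv
  have Sv : Sol (Qd n ψ 0) v := F.hc.lin F.hs _ _
  have v0 : v 0 = -deriv u 0 := by simp [hv, F.c0, F.s0]
  have v1 : deriv v 0 = u 0 := by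
    have := ((F.hc.h0 0).const_mul (-deriv u 0)).add ((F.hs.h0 0).const_mul (u 0))
    rw [F.c1, F.s1] at this
    have h := this.deriv
    simp only [mul_zero, zero_add, mul_one] at h
    exact h
  have hw : wr u v 0 ≠ 0 := by
    have e : wr u v 0 = u 0 * u 0 + deriv u 0 * deriv u 0 := by
      simp only [wr, v0, v1]; ring
    rw [e]
    intro h
    have h0 : u 0 = 0 := by nlinarith [mul_self_nonneg (u 0), mul_self_nonneg (deriv u 0)]
    have h1 : deriv u 0 = 0 := by nlinarith [mul_self_nonneg (u 0), mul_self_nonneg (deriv u 0)]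
    obtain ⟨t, s', hts⟩ := hnc
    apply hts
    refine is_const_of_deriv_eq_zero (fun t => (psi_h0 hψ t).differentiableAt) (fun t => ?_) t s'
    have := sol_rep F.hc F.hs F.c0 F.c1 F.s0 F.s1 Su t
    rw [h0, h1] at this
    simpa using this
  have Svs := Sv.shift (Qd_periodic hψ 0)
  set A := wr (fun t => v (t + T)) v 0 / wr u v 0 with hA
  have hshift : ∀ t, v (t + T) = A * u t + v t := by
    intro t
    have h := sol_span Su Sv Svs hw t
    have e : wr u (fun t => v (t + T)) 0 = wr u v 0 := by
      rw [wr_const Su Sv 0 T]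
      unfold wr
      rw [deriv_comp_add_const]
      have := uper 0
      have h2 := Periodic_deriv uper 0
      simp only [zero_add] at this h2 ⊢
      rw [this, h2]
    rw [e, div_self hw, one_mul] at h
    exact h
  have efun : (fun s => A / T * s * u s + (v s - A / T * s * u s)) = v := by
    funext s; ring
  have hvs : ContDiff ℝ (⊤ : ℕ∞) v := (contDiff_const.mul F.hcs).add (contDiff_const.mul F.hss)
  have hus : ContDiff ℝ (⊤ : ℕ∞) u := psi1_smooth hψ
  refine ⟨u, fun s => v s - A / T * s * u s, A / T, hus,
    hvs.sub ((contDiff_const.mul contDiff_id).mul hus), uper, ?_, Su, ?_, ?_⟩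
  · intro t
    simp only [hshift t, uper t]
    field_simp
    ring
  · rw [efun]; exact Sv
  · rw [efun]; exact hw

lemma part_two (hn : 3 ≤ n) (hψ : IsStdRadial n ψ T) :
    ∃ ρ : ℕ → ℝ,
      (∀ d, 1 ≤ d → 0 < ρ d) ∧
      (∀ d, 1 ≤ d → ∀ e, d < e → ρ d < ρ e) ∧
      Tendsto ρ atTop atTop ∧
      ρ 1 = 1 ∧ ∀ d, 1 ≤ d → Pack (Qd n ψ d) T (ρ d) := by
  have hT := hψ.2.1
  choose c s F using Qd_fund hψ hn
  set τ : ℕ → ℝ := fun d => (c d T + deriv (s d) T) / 2 with hτ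
  have lower : ∀ d : ℕ, 2 ≤ d → Real.cosh (((d : ℝ) - 1/2) * T) ≤ τ d ∧ 0 < s d T := by
    intro d hd
    have hd' : (2 : ℝ) ≤ d := by exact_mod_cast hd
    have := trace_lower (F d) hT (by linarith : (0:ℝ) < (d : ℝ) - 1/2) (Qd_ge_sq hψ hn d hd)
      (Qd_le hψ hn d)
    refine ⟨?_, this.2.2⟩
    simp only [hτ]
    linarith [this.1, this.2.1]
  have mono : ∀ d, 2 ≤ d → ∀ e, d < e → τ d < τ e := by
    intro d hd e hde
    have hde' : (d : ℝ) < e := by exact_mod_cast hde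
    have hd0 : (0 : ℝ) ≤ d := by positivity
    have hn' := n_ge hn
    have := trace_mono (F d) (F e) hT
      (fun t => (sq_nonneg _).trans (Qd_ge_sq hψ hn d hd t)) (Qd_le hψ hn e)
      (δ := (e : ℝ) * ((e : ℝ) + (n : ℝ) - 2) - (d : ℝ) * ((d : ℝ) + (n : ℝ) - 2))
      (by nlinarith) (fun t => by unfold Qd; ring)
    simp only [hτ]
    linarith
  have τ1 : ∀ d, 2 ≤ d → 1 ≤ τ d := fun d hd => (Real.one_le_cosh _).trans (lower d hd).1
  set ρ : ℕ → ℝ := fun d => if d = 1 then 1 else Real.arcosh (τ d) / T with hρ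
  have ρ1 : ρ 1 = 1 := by simp [hρ]
  have ρd : ∀ d, 2 ≤ d → ρ d = Real.arcosh (τ d) / T := by
    intro d hd
    have : d ≠ 1 := by omega
    simp [hρ, this]
  have ρlow : ∀ d : ℕ, 2 ≤ d → (d : ℝ) - 1/2 ≤ ρ d := by
    intro d hd
    have hd' : (2 : ℝ) ≤ d := by exact_mod_cast hd
    rw [ρd d hd, le_div_iff₀ hT]
    rw [← Real.arcosh_cosh (mul_nonneg (by linarith : (0:ℝ) ≤ (d : ℝ) - 1/2) hT.le)]
    exact (Real.arcosh_le_arcosh (Real.cosh_pos _) (by linarith [τ1 d hd])).2 (lower d hd).1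
  have ρpos : ∀ d, 1 ≤ d → 0 < ρ d := by
    intro d hd
    rcases hd.eq_or_lt with rfl | h2
    · rw [ρ1]; norm_num
    · have hd' : (2 : ℝ) ≤ d := by exact_mod_cast h2
      linarith [ρlow d h2]
  refine ⟨ρ, ρpos, ?_, ?_, ρ1, ?_⟩
  · intro d hd e hde
    rcases hd.eq_or_lt with rfl | h2
    · have he' : (2 : ℝ) ≤ e := by exact_mod_cast hde
      rw [ρ1]
      linarith [ρlow e hde]
    · have h2' : 2 ≤ d := h2
      have he : 2 ≤ e := by omega
      rw [ρd d h2, ρd e he]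
      gcongr
      exact (Real.arcosh_lt_arcosh (by linarith [τ1 d h2]) (by linarith [τ1 e he])).2
        (mono d h2 e hde)
  · refine tendsto_atTop_mono' atTop (f₁ := fun d : ℕ => (d : ℝ) - 1/2) ?_ ?_
    · filter_upwards [eventually_ge_atTop 2] with d hd using ρlow d hd
    · exact tendsto_atTop_add_const_right _ _ tendsto_natCast_atTop_atTop
  · intro d hd
    rcases hd.eq_or_lt with rfl | h2
    · rw [ρ1]; exact pack_one hn hψ
    · refine pack_of_trace (Qd_periodic hψ d) (F d) hT (ρpos d hd) (lower d h2).2.ne' ?_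
      rw [ρd d h2, div_mul_cancel₀ _ hT.ne', Real.cosh_arcosh (τ1 d h2)]
      simp only [hτ]
      ring

end

/-- Kernel of the linearized operators at a nonconstant radial factor. -/
theorem kernel_linearized_nonconstant_case
    (n : ℕ) (hn : 3 ≤ n) (ψ : ℝ → ℝ) (T : ℝ) (hψ : IsStdRadial n ψ T)
    (hnc : ∃ t s : ℝ, ψ t ≠ ψ s) :
    (∃ p₀p p₀m : ℝ → ℝ, ∃ a : ℝ,
      ContDiff ℝ (⊤ : ℕ∞) p₀p ∧ ContDiff ℝ (⊤ : ℕ∞) p₀m ∧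
      Function.Periodic p₀p T ∧ Function.Periodic p₀m T ∧
      (∀ t, odeOp n ψ 0 p₀p t = 0) ∧
      (∀ t, odeOp n ψ 0 (fun s => a * s * p₀p s + p₀m s) t = 0) ∧
      LinearIndependent ℝ ![p₀p, fun s => a * s * p₀p s + p₀m s] ∧
      ∀ η : ℝ → ℝ, ContDiff ℝ 2 η → (∀ t, odeOp n ψ 0 η t = 0) →
        ∃ A B : ℝ, ∀ t, η t = A * p₀p t + B * (a * t * p₀p t + p₀m t)) ∧
    (∃ ρ : ℕ → ℝ,
      (∀ d, 1 ≤ d → 0 < ρ d) ∧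
      (∀ d, 1 ≤ d → ∀ e, d < e → ρ d < ρ e) ∧
      Tendsto ρ atTop atTop ∧
      ρ 1 = 1 ∧
      ∀ d, 1 ≤ d →
        ∃ pdp pdm : ℝ → ℝ,
          ContDiff ℝ (⊤ : ℕ∞) pdp ∧ ContDiff ℝ (⊤ : ℕ∞) pdm ∧
          Function.Periodic pdp T ∧ Function.Periodic pdm T ∧
          (∀ t, odeOp n ψ d (fun s => Real.exp (-ρ d * s) * pdp s) t = 0) ∧
          (∀ t, odeOp n ψ d (fun s => Real.exp (ρ d * s) * pdm s) t = 0) ∧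
          LinearIndependent ℝ
            ![fun s => Real.exp (-ρ d * s) * pdp s, fun s => Real.exp (ρ d * s) * pdm s] ∧
          ∀ η : ℝ → ℝ, ContDiff ℝ 2 η → (∀ t, odeOp n ψ d η t = 0) →
            ∃ A B : ℝ, ∀ t, η t = A * (Real.exp (-ρ d * t) * pdp t)
              + B * (Real.exp (ρ d * t) * pdm t)) := by
  have hsol : ∀ d η, Sol (Qd n ψ d) η → ∀ t, odeOp n ψ d η t = 0 := fun d η h t =>
    (odeOp_zero_iff n ψ d η t).2 (h.eq t)
  have hsol' : ∀ d η, ContDiff ℝ 2 η → (∀ t, odeOp n ψ d η t = 0) → Sol (Qd n ψ d) η :=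
    fun d η hc h => Sol.of_contDiff hc fun t => (odeOp_zero_iff n ψ d η t).1 (h t)
  constructor
  · obtain ⟨u, w, a, hu, hw, pu, pw, Su, Sv, hwr⟩ := part_one hn hψ hnc
    exact ⟨u, w, a, hu, hw, pu, pw, hsol _ _ Su, hsol _ _ Sv, sol_indep Su.d0 Sv.d0 0 hwr,
      fun η hη he => ⟨_, _, fun t => sol_span Su Sv (hsol' _ _ hη he) hwr t⟩⟩
  · obtain ⟨ρ, h1, h2, h3, h4, h5⟩ := part_two hn hψ
    refine ⟨ρ, h1, h2, h3, h4, fun d hd => ?_⟩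
    obtain ⟨u, w, hu, hw, pu, pw, Su, Sv, t0, hwr⟩ := h5 d hd
    refine ⟨u, w, hu, hw, pu, pw, hsol _ _ Su, hsol _ _ Sv, sol_indep Su.d0 Sv.d0 t0 hwr, ?_⟩
    rw [wr_const Su Sv t0 0] at hwr
    exact fun η hη he => ⟨_, _, fun t => sol_span Su Sv (hsol' _ _ hη he) hwr t⟩
end
end

section
/- Let n ≥ 3 be an integer, ψ a standard radial factor, μ > 1, 0 < r₀ ≤ 1, and F a continuous function on B_{r₀} \ {0}. Suppose W₁ and W₂ are C² functions on {x ∈ ℝⁿ : 0 < |x| ≤ r₀} satisfying L_ψ W_i = F in B_{r₀} \ {0} for i = 1, 2, with W₁(x) = W₂(x) for every x with |x| = r₀, and suppose there is a constant C > 0 such that |D^j W_i(x)| ≤ C |x|^{μ − (n−2)/2 − j} for j = 0, 1, 2, i = 1, 2, and all 0 < |x| ≤ r₀ (where D^j denotes the j-th Fréchet derivative). Then W₁ = W₂ on {0 < |x| ≤ r₀}. -/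
open scoped Topology ENNReal
open Metric Filter MeasureTheory

noncomputable section

lemma second_deriv_line {V : Type*} [NormedAddCommGroup V] [NormedSpace ℝ V] {u : V → ℝ} {x : V} (hu : ContDiffAt ℝ 2 u x) (v : V) :
    iteratedFDeriv ℝ 2 u x (fun _ => v) = deriv (deriv (fun τ : ℝ => u (x + τ • v))) 0 := by
  have hline : ∀ τ : ℝ, HasDerivAt (fun τ : ℝ => x + τ • v) v τ := by
    intro τ
    simpa using ((hasDerivAt_id τ).smul_const v).const_add x
  have hc : Tendsto (fun τ : ℝ => x + τ • v) (𝓝 0) (𝓝 x) := by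
    have := (hline 0).continuousAt.tendsto
    simpa using this
  have h1 : ∀ᶠ y in 𝓝 x, DifferentiableAt ℝ u y := by
    filter_upwards [hu.eventually (by simp)] with y hy
    exact hy.differentiableAt (by norm_num)
  have h2 : (deriv (fun τ : ℝ => u (x + τ • v))) =ᶠ[𝓝 0] fun τ => fderiv ℝ u (x + τ • v) v := by
    filter_upwards [hc.eventually h1] with τ hτ
    exact (hτ.hasFDerivAt.comp_hasDerivAt τ (hline τ)).deriv
  rw [h2.deriv_eq, iteratedFDeriv_two_apply]
  have h3 : DifferentiableAt ℝ (fderiv ℝ u) x :=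
    (hu.fderiv_right (m := 1) (by norm_num)).differentiableAt (by norm_num)
  have h4 : HasFDerivAt (fderiv ℝ u) (fderiv ℝ (fderiv ℝ u) x) (x + (0:ℝ) • v) := by
    simpa using h3.hasFDerivAt
  have h5 : HasDerivAt (fun τ : ℝ => fderiv ℝ u (x + τ • v))
      (fderiv ℝ (fderiv ℝ u) x v) 0 := h4.comp_hasDerivAt (0:ℝ) (hline 0)
  have h6 : HasDerivAt (fun τ : ℝ => fderiv ℝ u (x + τ • v) v)
      (fderiv ℝ (fderiv ℝ u) x v v) 0 :=
    (ContinuousLinearMap.apply ℝ ℝ v).hasFDerivAt.comp_hasDerivAt (0:ℝ) h5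
  exact h6.deriv.symm

lemma deriv2_nonpos_of_isLocalMax {g : ℝ → ℝ} {a : ℝ} (h : IsLocalMax g a)
    (hc : ContinuousAt g a) : deriv (deriv g) a ≤ 0 := by
  by_contra hcon
  push Not at hcon
  have hmin := isLocalMin_of_deriv_deriv_pos hcon h.deriv_eq_zero hc
  have : g =ᶠ[𝓝 a] fun _ => g a := by
    filter_upwards [h, hmin] with y h1 h2
    exact le_antisymm h1 h2
  have h2 : deriv g =ᶠ[𝓝 a] deriv (fun _ => g a) := this.deriv
  rw [h2.deriv_eq] at hcon
  simp at hcon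

lemma lap_nonpos_of_isLocalMax {n : ℕ} {u : E n → ℝ} {x : E n} (hu : ContDiffAt ℝ 2 u x)
    (h : IsLocalMax u x) : lap n u x ≤ 0 := by
  unfold lap
  refine Finset.sum_nonpos fun i _ => ?_
  rw [second_deriv_line hu]
  have hcx : Continuous (fun τ : ℝ => x + τ • (EuclideanSpace.single i (1:ℝ) : E n)) := by fun_prop
  have hc : Tendsto (fun τ : ℝ => x + τ • (EuclideanSpace.single i (1:ℝ) : E n)) (𝓝 0) (𝓝 x) := by
    have := hcx.tendsto 0
    simpa using this
  apply deriv2_nonpos_of_isLocalMax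
  · have := hc.eventually h
    simpa [IsLocalMax, IsMaxFilter] using this
  · have : ContinuousAt u (x + (0:ℝ) • (EuclideanSpace.single i (1:ℝ) : E n)) := by
      simpa using hu.continuousAt
    exact ContinuousAt.comp (f := fun τ : ℝ => x + τ • (EuclideanSpace.single i (1:ℝ) : E n)) this
      hcx.continuousAt

lemma lap_eq_laplacian {n : ℕ} (u : E n → ℝ) (x : E n) (v : OrthonormalBasis (Fin n) ℝ (E n)) :
    lap n u x = ∑ i, iteratedFDeriv ℝ 2 u x (fun _ => v i) := by
  have h1 := congrFun (InnerProductSpace.laplacian_eq_iteratedFDeriv_orthonormalBasis u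
    (EuclideanSpace.basisFun (Fin n) ℝ)) x
  have h2 := congrFun (InnerProductSpace.laplacian_eq_iteratedFDeriv_orthonormalBasis u v) x
  rw [h1] at h2
  have e : ∀ w : E n, (![w, w] : Fin 2 → E n) = fun _ => w := by
    intro w; ext i; fin_cases i <;> rfl
  simpa [lap, e] using h2

lemma lap_comp_isometry {n : ℕ} (R : E n ≃ₗᵢ[ℝ] E n) {u : E n → ℝ} {x : E n}
    (hu : ContDiffAt ℝ 2 u (R x)) : lap n (fun y => u (R y)) x = lap n u (R x) := by
  rw [lap_eq_laplacian u (R x) ((EuclideanSpace.basisFun (Fin n) ℝ).map R)]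
  unfold lap
  refine Finset.sum_congr rfl fun i _ => ?_
  have hc : ContDiffAt ℝ 2 (fun y => u (R y)) x :=
    ContDiffAt.comp (g := u) (f := R) x hu R.contDiff.contDiffAt
  rw [second_deriv_line hu, second_deriv_line hc]
  simp

lemma lap_sub' {n : ℕ} {u v : E n → ℝ} {x : E n} (hu : ContDiffAt ℝ 2 u x)
    (hv : ContDiffAt ℝ 2 v x) : lap n (fun y => u y - v y) x = lap n u x - lap n v x := by
  unfold lap
  rw [← Finset.sum_sub_distrib]
  refine Finset.sum_congr rfl fun i _ => ?_
  have := iteratedFDeriv_sub_apply hu hv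
  have h2 : (fun y => u y - v y) = u - v := rfl
  rw [h2, this]; rfl

lemma lap_add' {n : ℕ} {u v : E n → ℝ} {x : E n} (hu : ContDiffAt ℝ 2 u x)
    (hv : ContDiffAt ℝ 2 v x) : lap n (fun y => u y + v y) x = lap n u x + lap n v x := by
  unfold lap
  rw [← Finset.sum_add_distrib]
  refine Finset.sum_congr rfl fun i _ => ?_
  have := iteratedFDeriv_add_apply hu hv
  have h2 : (fun y => u y + v y) = u + v := rfl
  rw [h2, this]; rfl

lemma lap_smul' {n : ℕ} (c : ℝ) {u : E n → ℝ} {x : E n} (hu : ContDiffAt ℝ 2 u x) :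
    lap n (fun y => c * u y) x = c * lap n u x := by
  unfold lap
  rw [Finset.mul_sum]
  refine Finset.sum_congr rfl fun i _ => ?_
  have := iteratedFDeriv_const_smul_apply (a := c) hu
  have h2 : (fun y => c * u y) = c • u := rfl
  rw [h2, this]; rfl

lemma lap_congr' {n : ℕ} {u v : E n → ℝ} {x : E n} (h : u =ᶠ[𝓝 x] v) :
    lap n u x = lap n v x := by
  unfold lap
  rw [(h.iteratedFDeriv ℝ 2).eq_of_nhds]

lemma lap_product {n : ℕ} (e x : E n) (q q' f f' : ℝ → ℝ) (q'' f'' : ℝ)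
    (hq : ∀ y, HasDerivAt q (q' y) y) (hq' : HasDerivAt q' q'' (inner ℝ e x))
    (hf : ∀ᶠ y in 𝓝 (‖x‖ ^ 2), HasDerivAt f (f' y) y) (hf' : HasDerivAt f' f'' (‖x‖ ^ 2))
    (hu : ContDiffAt ℝ 2 (fun y : E n => q (inner ℝ e y) * f (‖y‖ ^ 2)) x) :
    lap n (fun y : E n => q (inner ℝ e y) * f (‖y‖ ^ 2)) x =
      q'' * ‖e‖ ^ 2 * f (‖x‖ ^ 2) + 4 * q' (inner ℝ e x) * inner ℝ e x * f' (‖x‖ ^ 2)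
       + q (inner ℝ e x) * (4 * ‖x‖ ^ 2 * f'' + 2 * n * f' (‖x‖ ^ 2)) := by
  unfold lap
  have key : ∀ i : Fin n, iteratedFDeriv ℝ 2 (fun y : E n => q (inner ℝ e y) * f (‖y‖ ^ 2)) x
      (fun _ => EuclideanSpace.single i 1) =
      q'' * f (‖x‖ ^ 2) * (e i) ^ 2 + (4 * q' (inner ℝ e x) * f' (‖x‖ ^ 2)) * (x i * e i)
       + (q (inner ℝ e x) * f'' * 4) * (x i) ^ 2 + q (inner ℝ e x) * f' (‖x‖ ^ 2) * 2 := by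
    intro i
    rw [second_deriv_line hu]
    have e1 : ∀ τ : ℝ, inner ℝ e (x + τ • (EuclideanSpace.single i (1:ℝ) : E n))
        = inner ℝ e x + τ * e i := by
      intro τ
      rw [inner_add_right, inner_smul_right, EuclideanSpace.inner_single_right]
      simp
    have e2 : ∀ τ : ℝ, ‖x + τ • (EuclideanSpace.single i (1:ℝ) : E n)‖ ^ 2
        = ‖x‖ ^ 2 + 2 * x i * τ + τ ^ 2 := by
      intro τ
      rw [norm_add_sq_real, inner_smul_right, EuclideanSpace.inner_single_right, norm_smul]
      simp
      ring
    simp only [e1, e2]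
    set p := inner ℝ e x
    set s := ‖x‖ ^ 2
    have ha : ∀ τ : ℝ, HasDerivAt (fun τ => p + τ * e i) (e i) τ := by
      intro τ
      simpa using ((hasDerivAt_id τ).mul_const (e i)).const_add p
    have hb : ∀ τ : ℝ, HasDerivAt (fun τ => s + 2 * x i * τ + τ ^ 2) (2 * x i + 2 * τ) τ := by
      intro τ
      have := (((hasDerivAt_id τ).const_mul (2 * x i)).const_add s).add (hasDerivAt_pow 2 τ)
      convert! this using 1
      simp
    have hbc : Tendsto (fun τ : ℝ => s + 2 * x i * τ + τ ^ 2) (𝓝 0) (𝓝 s) := by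
      simpa using (hb 0).continuousAt.tendsto
    have d1 : deriv (fun τ => q (p + τ * e i) * f (s + 2 * x i * τ + τ ^ 2)) =ᶠ[𝓝 0]
        fun τ => q' (p + τ * e i) * e i * f (s + 2 * x i * τ + τ ^ 2)
          + q (p + τ * e i) * (f' (s + 2 * x i * τ + τ ^ 2) * (2 * x i + 2 * τ)) := by
      filter_upwards [hbc.eventually hf] with τ hτ
      exact (((hq _).comp τ (ha τ)).mul (HasDerivAt.comp τ hτ (hb τ))).deriv
    rw [d1.deriv_eq]
    have hq'0 : HasDerivAt q' q'' (p + 0 * e i) := by simpa using hq'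
    have hf0 : HasDerivAt f (f' s) (s + 2 * x i * 0 + 0 ^ 2) := by simpa using hf.self_of_nhds
    have hf'0 : HasDerivAt f' f'' (s + 2 * x i * 0 + 0 ^ 2) := by simpa using hf'
    have hlin : HasDerivAt (fun τ : ℝ => 2 * x i + 2 * τ) 2 0 := by
      simpa using ((hasDerivAt_id (0:ℝ)).const_mul 2).const_add (2 * x i)
    have H := ((((hq'0.comp (0:ℝ) (ha 0)).mul_const (e i)).mul (hf0.comp (0:ℝ) (hb 0))).add
      (((hq _).comp (0:ℝ) (ha 0)).mul ((hf'0.comp (0:ℝ) (hb 0)).mul hlin))).deriv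
    refine Eq.trans H ?_
    simp
    ring
  rw [Finset.sum_congr rfl fun i _ => key i]
  simp only [Finset.sum_add_distrib, ← Finset.mul_sum]
  have s1 : ∑ i, (e i) ^ 2 = ‖e‖ ^ 2 := by rw [EuclideanSpace.real_norm_sq_eq]
  have s2 : ∑ i, (x i) ^ 2 = ‖x‖ ^ 2 := by rw [EuclideanSpace.real_norm_sq_eq]
  have s3 : ∑ i, x i * e i = inner ℝ e x := by
    simp [PiLp.inner_apply]
  rw [s1, s2, s3]
  simp
  ring

lemma radF_deriv (α : ℝ) (η : ℝ → ℝ) (η1 y : ℝ) (hy : 0 < y)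
    (h : HasDerivAt η η1 (-(1/2) * Real.log y)) :
    HasDerivAt (fun y => y ^ (-α) * η (-(1/2) * Real.log y))
      (y ^ (-(α + 1)) * (-α * η (-(1/2) * Real.log y) - 1/2 * η1)) y := by
  have h1 : HasDerivAt (fun y : ℝ => y ^ (-α)) (-α * y ^ (-α - 1)) y :=
    Real.hasDerivAt_rpow_const (Or.inl hy.ne')
  have h2 : HasDerivAt (fun y : ℝ => -(1/2) * Real.log y) (-(1/2) * y⁻¹) y :=
    (Real.hasDerivAt_log hy.ne').const_mul _
  have h3 := h1.mul (HasDerivAt.comp y h h2)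
  convert! h3 using 1
  have : y ^ (-α) = y ^ (-(α+1)) * y := by
    rw [← Real.rpow_add_one hy.ne']; congr 1; ring
  have h4 : -α - 1 = -(α+1) := by ring
  simp only [Function.comp, h4, this]
  field_simp
  ring

lemma lap_mode {n : ℕ} (m k : ℝ) (hm : (n : ℝ) = 2 * m + 2) (e x : E n) (hx : 0 < ‖x‖)
    (q q' η η' : ℝ → ℝ) (q'' η'' : ℝ)
    (hq : ∀ y, HasDerivAt q (q' y) y) (hq' : HasDerivAt q' q'' (inner ℝ e x))
    (hk : q' (inner ℝ e x) * inner ℝ e x = k * q (inner ℝ e x))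
    (hη : ∀ᶠ t in 𝓝 (-Real.log ‖x‖), HasDerivAt η (η' t) t)
    (hη' : HasDerivAt η' η'' (-Real.log ‖x‖))
    (hu : ContDiffAt ℝ 2 (fun y : E n => q (inner ℝ e y) *
      ((‖y‖ ^ 2) ^ (-((m + k) / 2)) * η (-(1/2) * Real.log (‖y‖ ^ 2)))) x) :
    lap n (fun y : E n => q (inner ℝ e y) *
      ((‖y‖ ^ 2) ^ (-((m + k) / 2)) * η (-(1/2) * Real.log (‖y‖ ^ 2)))) x =
    (‖x‖ ^ 2) ^ (-((m + k) / 2 + 1)) * (q'' * ‖e‖ ^ 2 * ‖x‖ ^ 2 * η (-Real.log ‖x‖)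
      + q (inner ℝ e x) * (η'' - (m + k) ^ 2 * η (-Real.log ‖x‖))) := by
  have hs : 0 < ‖x‖ ^ 2 := by positivity
  have hlog : -(1/2) * Real.log (‖x‖ ^ 2) = -Real.log ‖x‖ := by
    rw [Real.log_pow]; push_cast; ring
  set α := (m + k) / 2 with hα
  have hcont : Tendsto (fun y : ℝ => -(1/2) * Real.log y) (𝓝 (‖x‖ ^ 2)) (𝓝 (-Real.log ‖x‖)) := by
    rw [← hlog]
    exact ((Real.continuousAt_log hs.ne').const_mul _).tendsto
  have hf : ∀ᶠ y in 𝓝 (‖x‖ ^ 2), HasDerivAt (fun y => y ^ (-α) * η (-(1/2) * Real.log y))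
      ((fun y => y ^ (-(α + 1)) * (fun t => -α * η t - 1/2 * η' t) (-(1/2) * Real.log y)) y) y := by
    filter_upwards [hcont.eventually hη, lt_mem_nhds hs] with y h1 h2
    exact radF_deriv α η _ y h2 h1
  have hη2 : HasDerivAt (fun t => -α * η t - 1/2 * η' t) (-α * η' (-Real.log ‖x‖) - 1/2 * η'')
      (-(1/2) * Real.log (‖x‖ ^ 2)) := by
    rw [hlog]
    exact (hη.self_of_nhds.const_mul _).sub (hη'.const_mul _)
  have hf' := radF_deriv (α + 1) (fun t => -α * η t - 1/2 * η' t) _ (‖x‖ ^ 2) hs hη2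
  have H := lap_product e x q q' (fun y => y ^ (-α) * η (-(1/2) * Real.log y)) _ q'' _ hq hq' hf hf' hu
  rw [H]
  simp only [hlog, hm]
  have r1 : (‖x‖ ^ 2) ^ (-α) = (‖x‖ ^ 2) ^ (-(α+1)) * ‖x‖ ^ 2 := by
    rw [← Real.rpow_add_one hs.ne']; congr 1; ring
  have r2 : (‖x‖ ^ 2) ^ (-(α+1)) = (‖x‖ ^ 2) ^ (-(α+1+1)) * ‖x‖ ^ 2 := by
    rw [← Real.rpow_add_one hs.ne']; congr 1; ring
  have hm' : m = 2 * α - k := by rw [hα]; ring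
  rw [r1, r2]
  set A := (‖x‖ ^ 2) ^ (-(α+1+1))
  set s := ‖x‖ ^ 2
  set p := (inner ℝ e x : ℝ)
  clear_value A s p α
  subst hm'
  linear_combination (4 * A * s * (-α * η (-Real.log ‖x‖) - 1/2 * η' (-Real.log ‖x‖))) * hk

lemma psi_facts {n : ℕ} (m : ℝ) (hm0 : 0 < m) (hm : (n : ℝ) = 2 * m + 2) {ψ : ℝ → ℝ} {T : ℝ}
    (hψ : IsStdRadial n ψ T) :
    (∀ t, HasDerivAt ψ (deriv ψ t) t) ∧
    (∀ t, HasDerivAt (deriv ψ) (m ^ 2 * ψ t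
        - m * (m + 1) * (ψ t * ψ t ^ ((4 : ℝ) / ((n : ℝ) - 2)))) t) ∧
    (∀ t, HasDerivAt (fun t => ψ t ^ ((4 : ℝ) / ((n : ℝ) - 2)))
      (2 / m * (ψ t ^ ((4 : ℝ) / ((n : ℝ) - 2)) * deriv ψ t / ψ t)) t) ∧
    ∃ h > 0, ∀ t, m ^ 2 * (ψ t ^ 2 - ψ t ^ 2 * ψ t ^ ((4 : ℝ) / ((n : ℝ) - 2))) - deriv ψ t ^ 2
      = m ^ 2 * h := by
  obtain ⟨hsm, hT, hper, h01, hode⟩ := hψ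
  have hd1 : ∀ t, HasDerivAt ψ (deriv ψ t) t := fun t =>
    ((hsm.differentiable (by simp)) t).hasDerivAt
  have hsm' : ContDiff ℝ 1 (deriv ψ) := by
    have : ContDiff ℝ (1 + 1) ψ := hsm.of_le (by norm_cast)
    exact (contDiff_succ_iff_deriv.1 this).2.2
  have hn2 : (n:ℝ) - 2 = 2 * m := by rw [hm]; ring
  have hq : (4:ℝ) / ((n:ℝ) - 2) = 2 / m := by rw [hn2]; field_simp; ring
  have hp : ((n:ℝ) + 2) / ((n:ℝ) - 2) = 1 + 2 / m := by rw [hn2, hm]; field_simp; ring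
  rw [hq]
  have hd2 : ∀ t, HasDerivAt (deriv ψ) (m ^ 2 * ψ t - m * (m + 1) * (ψ t * ψ t ^ (2 / m))) t := by
    intro t
    have h1 := ((hsm'.differentiable (by simp)) t).hasDerivAt
    have h2 := hode t
    rw [hp, Real.rpow_add (h01 t).1, Real.rpow_one, hm] at h2
    convert! h1 using 1
    linear_combination -h2
  have hd3 : ∀ t, HasDerivAt (fun t => ψ t ^ (2 / m)) (2 / m * (ψ t ^ (2 / m) * deriv ψ t / ψ t)) t := by
    intro t
    have h1 := (hd1 t).rpow_const (p := 2 / m) (Or.inl (h01 t).1.ne')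
    convert! h1 using 1
    rw [Real.rpow_sub_one (h01 t).1.ne']
    ring
  refine ⟨hd1, hd2, hd3, ?_⟩
  set H : ℝ → ℝ := fun t => m ^ 2 * (ψ t ^ 2 - ψ t ^ 2 * ψ t ^ (2 / m)) - deriv ψ t ^ 2 with hH
  have hconst : ∀ t s, H t = H s := by
    apply is_const_of_deriv_eq_zero
    · intro t
      exact (((((hd1 t).pow 2).sub (((hd1 t).pow 2).mul (hd3 t))).const_mul _).sub
        ((hd2 t).pow 2)).differentiableAt
    · intro t
      have := (((((hd1 t).pow 2).sub (((hd1 t).pow 2).mul (hd3 t))).const_mul (m^2)).sub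
        ((hd2 t).pow 2)).deriv
      refine Eq.trans this ?_
      have := (h01 t).1.ne'
      simp
      field_simp
      ring
  obtain ⟨t0, ht0, hmax⟩ := isCompact_Icc.exists_isMaxOn (s := Set.Icc 0 T)
    ⟨0, Set.left_mem_Icc.2 hT.le⟩ hsm.continuous.continuousOn
  have hmax' : ∀ t, ψ t ≤ ψ t0 := by
    intro t
    obtain ⟨y, hy, hyt⟩ := hper.exists_mem_Ico₀ hT t
    rw [hyt]
    exact hmax (Set.Ico_subset_Icc_self hy)
  have hd0 : deriv ψ t0 = 0 := IsLocalMax.deriv_eq_zero (Eventually.of_forall hmax')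
  refine ⟨H t0 / m ^ 2, ?_, fun t => ?_⟩
  · simp only [hH, hd0]
    have h2 : ψ t0 ^ (2 / m) < 1 := Real.rpow_lt_one (h01 t0).1.le (h01 t0).2 (by positivity)
    have h1 := (h01 t0).1
    have : 0 < m ^ 2 * (ψ t0 ^ 2 * (1 - ψ t0 ^ (2 / m))) := by
      have : 0 < 1 - ψ t0 ^ (2 / m) := by linarith
      positivity
    apply div_pos _ (by positivity)
    linarith
  · have := hconst t t0
    simp only [hH] at this ⊢
    rw [this]
    field_simp

lemma phi_facts {m : ℝ} (hm0 : 0 < m) {ψ X : ℝ → ℝ} (hpos : ∀ t, 0 < ψ t)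
    (hd1 : ∀ t, HasDerivAt ψ (deriv ψ t) t)
    (hd2 : ∀ t, HasDerivAt (deriv ψ) (m ^ 2 * ψ t - m * (m + 1) * (ψ t * X t)) t)
    (h : ℝ) (hH : ∀ t, m ^ 2 * (ψ t ^ 2 - ψ t ^ 2 * X t) - deriv ψ t ^ 2 = m ^ 2 * h) :
    ∃ η' : ℝ → ℝ, (∀ t, HasDerivAt (fun t => ψ t ^ ((m + 1) / m)) (η' t) t) ∧
      ∀ t, HasDerivAt η' (((m + 1) ^ 2 - (m + 1) * h / ψ t ^ 2 - (m + 1) * (m + 2) * X t)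
        * ψ t ^ ((m + 1) / m)) t := by
  have h1 : ∀ t, HasDerivAt (fun t => ψ t ^ ((m + 1) / m))
      ((m + 1) / m * (ψ t ^ ((m + 1) / m) * deriv ψ t / ψ t)) t := by
    intro t
    have h1 := (hd1 t).rpow_const (p := (m + 1) / m) (Or.inl (hpos t).ne')
    convert! h1 using 1
    rw [Real.rpow_sub_one (hpos t).ne']
    ring
  refine ⟨_, h1, fun t => ?_⟩
  have h2 := (((h1 t).mul (hd2 t)).div (hd1 t) (hpos t).ne').const_mul ((m + 1) / m)
  convert! h2 using 1
  have h3 := hH t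
  have h4 := (hpos t).ne'
  simp only [Pi.mul_apply]
  field_simp
  have h5 : deriv ψ t ^ 2 = m ^ 2 * (ψ t ^ 2 - ψ t ^ 2 * X t) - m ^ 2 * h := by linarith
  linear_combination (-(ψ t ^ ((m + 1) / m))) * h5

lemma contDiffAt_mode {n : ℕ} (α : ℝ) (e x : E n) (hx : 0 < ‖x‖) (q η : ℝ → ℝ)
    (hq : ContDiff ℝ 2 q) (hη : ContDiffAt ℝ 2 η (-Real.log ‖x‖)) :
    ContDiffAt ℝ 2 (fun y : E n => q (inner ℝ e y) *
      ((‖y‖ ^ 2) ^ (-α) * η (-(1/2) * Real.log (‖y‖ ^ 2)))) x := by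
  have hs : ‖x‖ ^ 2 ≠ 0 := by positivity
  have hlog : -(1/2) * Real.log (‖x‖ ^ 2) = -Real.log ‖x‖ := by
    rw [Real.log_pow]; push_cast; ring
  have h1 : ContDiffAt ℝ 2 (fun y : E n => ‖y‖ ^ 2) x := (contDiff_norm_sq ℝ).contDiffAt
  have h2 : ContDiffAt ℝ 2 (fun y : E n => (inner ℝ e y : ℝ)) x :=
    (contDiff_const.inner ℝ contDiff_id).contDiffAt
  have h3 : ContDiffAt ℝ 2 (fun y : E n => -(1/2) * Real.log (‖y‖ ^ 2)) x :=
    contDiffAt_const.mul (h1.log hs)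
  refine ((hq.contDiffAt).comp x h2).mul ((h1.rpow_const_of_ne hs).mul ?_)
  rw [← hlog] at hη
  exact ContDiffAt.comp (f := fun y : E n => -(1/2) * Real.log (‖y‖ ^ 2)) x hη h3

set_option maxHeartbeats 1000000 in
lemma barrier {n : ℕ} (m : ℝ) (hm0 : 0 < m) (hm : (n : ℝ) = 2 * m + 2) {ψ : ℝ → ℝ} {T : ℝ}
    (hψ : IsStdRadial n ψ T) (e : E n) (he : ‖e‖ = 1) :
    ∃ G : E n → ℝ, ∃ c0 > 0, (∀ x, 0 < ‖x‖ → ContDiffAt ℝ 2 G x) ∧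
      (∀ x, 0 < ‖x‖ → 0 ≤ (inner ℝ e x : ℝ) → c0 * ‖x‖ ^ (-m) ≤ G x) ∧
      (∀ x, 0 < ‖x‖ → 0 ≤ (inner ℝ e x : ℝ) → linYamabe n ψ G x < 0) := by
  obtain ⟨hd1, hd2, hd3, h, hh, hH⟩ := psi_facts m hm0 hm hψ
  obtain ⟨hsm, hT, hper, h01, hode⟩ := hψ
  set X : ℝ → ℝ := fun t => ψ t ^ ((4 : ℝ) / ((n : ℝ) - 2)) with hX
  have hX0 : ∀ t, 0 < X t := fun t => Real.rpow_pos_of_pos (h01 t).1 _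
  obtain ⟨φ', hφ1, hφ2⟩ := phi_facts (X := X) hm0 (fun t => (h01 t).1) hd1 hd2 h hH
  set φ : ℝ → ℝ := fun t => ψ t ^ ((m + 1) / m) with hφ
  have hφ0 : ∀ t, 0 < φ t := fun t => Real.rpow_pos_of_pos (h01 t).1 _
  have hφc : ∀ t, ContDiffAt ℝ 2 φ t := fun t =>
    ((hsm.of_le (by norm_cast)).contDiffAt).rpow_const_of_ne (h01 t).1.ne'
  have hψh : ∀ t, h ≤ ψ t ^ 2 := by
    intro t
    have h1 := hH t
    have h2 : 0 ≤ m ^ 2 * (ψ t ^ 2 * X t) := by have := hX0 t; positivity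
    have h3 : m ^ 2 * h ≤ m ^ 2 * ψ t ^ 2 := by nlinarith [sq_nonneg (deriv ψ t)]
    exact le_of_mul_le_mul_left h3 (by positivity)
  set κ0 := (m + 1) * h with hκ0
  have hκ0p : 0 < κ0 := by positivity
  set δ := min (1 / (2 * m + 1)) (κ0 / ((2 * m + 1) * (2 * m + 3))) with hδ
  have hδp : 0 < δ := by
    apply lt_min <;> positivity
  set B := (2 * m + 1) * δ / 2 with hB
  have hBp : 0 < B := by positivity
  have hB1 : B ≤ 1 / 2 := by
    have : δ ≤ 1 / (2 * m + 1) := min_le_left _ _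
    rw [le_div_iff₀ (by positivity)] at this
    rw [hB]; linarith
  have hB2 : B * (2 * m + 3) ≤ κ0 / 2 := by
    have : δ ≤ κ0 / ((2 * m + 1) * (2 * m + 3)) := min_le_right _ _
    rw [le_div_iff₀ (by positivity)] at this
    rw [hB]; linarith
  set M : ℝ → (ℝ → ℝ) → E n → ℝ := fun k q y => q (inner ℝ e y) *
      ((‖y‖ ^ 2) ^ (-((m + k) / 2)) * φ (-(1/2) * Real.log (‖y‖ ^ 2))) with hM
  have hMc : ∀ k q x, ContDiff ℝ 2 q → 0 < ‖x‖ → ContDiffAt ℝ 2 (M k q) x :=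
    fun k q x hq hx => contDiffAt_mode _ e x hx q φ hq (hφc _)
  have c0 : ContDiff ℝ 2 (fun _ : ℝ => (1:ℝ)) := contDiff_const
  have c1 : ContDiff ℝ 2 (fun y : ℝ => y) := contDiff_id
  have c2 : ContDiff ℝ 2 (fun y : ℝ => y ^ 2) := contDiff_id.pow 2
  set G : E n → ℝ := fun y => (δ * M 0 (fun _ => 1) y + M 1 (fun y => y) y)
    - B * M 2 (fun y => y ^ 2) y with hG
  have pw : ∀ r : ℝ, 0 < r → ∀ a : ℝ, (r ^ 2) ^ a = r ^ (2 * a) := by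
    intro r hr a
    rw [← Real.rpow_natCast, ← Real.rpow_mul hr.le]; norm_num
  have hlog : ∀ x : E n, -(1/2) * Real.log (‖x‖ ^ 2) = -Real.log ‖x‖ := by
    intro x
    rw [Real.log_pow]; push_cast; ring
  have hGval : ∀ x, 0 < ‖x‖ → G x = ‖x‖ ^ (-m) * φ (-Real.log ‖x‖) *
      (δ + inner ℝ e x / ‖x‖ - B * (inner ℝ e x / ‖x‖) ^ 2) := by
    intro x hx
    simp only [hG, hM, hlog]
    rw [pw _ hx, pw _ hx, pw _ hx]
    have e0 : 2 * -((m + 0) / 2) = -m := by ring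
    have e1 : 2 * -((m + 1) / 2) = -m - 1 := by ring
    have e2 : 2 * -((m + 2) / 2) = -m - 1 - 1 := by ring
    rw [e0, e1, e2]
    simp only [Real.rpow_sub_one hx.ne']
    field_simp
  have hθ : ∀ x : E n, 0 < ‖x‖ → (inner ℝ e x : ℝ) / ‖x‖ ≤ 1 := by
    intro x hx
    rw [div_le_one hx]
    have := real_inner_le_norm e x
    rwa [he, one_mul] at this
  refine ⟨G, δ * Real.sqrt h ^ ((m + 1) / m), ?_, ?_, ?_, ?_⟩
  · have := Real.sqrt_pos.2 hh
    positivity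
  · intro x hx
    exact ((contDiffAt_const.mul (hMc _ _ x c0 hx)).add (hMc _ _ x c1 hx)).sub
      (contDiffAt_const.mul (hMc _ _ x c2 hx))
  · intro x hx hp
    rw [hGval x hx]
    have h1 := hθ x hx
    have h2 : 0 ≤ (inner ℝ e x : ℝ) / ‖x‖ := by positivity
    set θ := (inner ℝ e x : ℝ) / ‖x‖
    have h3 : δ ≤ δ + θ - B * θ ^ 2 := by nlinarith
    have h4 : Real.sqrt h ^ ((m + 1) / m) ≤ φ (-Real.log ‖x‖) := by
      apply Real.rpow_le_rpow (Real.sqrt_nonneg _) _ (by positivity)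
      rw [← Real.sqrt_sq (h01 (-Real.log ‖x‖)).1.le]
      exact Real.sqrt_le_sqrt (hψh _)
    have h5 : 0 < ‖x‖ ^ (-m) := Real.rpow_pos_of_pos hx _
    calc _ = ‖x‖ ^ (-m) * (Real.sqrt h ^ ((m + 1) / m)) * δ := by ring
      _ ≤ _ := by
        have := hφ0 (-Real.log ‖x‖)
        gcongr
  · intro x hx hp
    unfold linYamabe
    have L0 := lap_mode m 0 hm e x hx (fun _ => 1) (fun _ => 0) φ φ' 0 _
      (fun y => hasDerivAt_const y 1) (hasDerivAt_const _ 0) (by simp) (Eventually.of_forall hφ1)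
      (hφ2 _) (hMc 0 _ x c0 hx)
    have L1 := lap_mode m 1 hm e x hx (fun y => y) (fun _ => 1) φ φ' 0 _
      (fun y => hasDerivAt_id y) (hasDerivAt_const _ 1) (by simp) (Eventually.of_forall hφ1)
      (hφ2 _) (hMc 1 _ x c1 hx)
    have L2 := lap_mode m 2 hm e x hx (fun y => y ^ 2) (fun y => 2 * y) φ φ' 2 _
      (fun y => by simpa using hasDerivAt_pow 2 y)
      (by simpa using (hasDerivAt_id (inner ℝ e x : ℝ)).const_mul 2) (by ring)
      (Eventually.of_forall hφ1) (hφ2 _) (hMc 2 _ x c2 hx)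
    have hlap : lap n G x = (δ * lap n (M 0 (fun _ => 1)) x + lap n (M 1 (fun y => y)) x)
        - B * lap n (M 2 (fun y => y ^ 2)) x := by
      rw [hG, lap_sub' ((contDiffAt_const.mul (hMc _ _ x c0 hx)).add (hMc _ _ x c1 hx))
        (contDiffAt_const.mul (hMc _ _ x c2 hx)),
        lap_add' (contDiffAt_const.mul (hMc _ _ x c0 hx)) (hMc _ _ x c1 hx),
        lap_smul' _ (hMc _ _ x c0 hx), lap_smul' _ (hMc _ _ x c2 hx)]
    rw [hlap, hGval x hx]
    simp only [hM]
    rw [L0, L1, L2, pw _ hx, pw _ hx, pw _ hx]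
    have e0 : 2 * -((m + 0) / 2 + 1) = -m - 1 - 1 := by ring
    have e1 : 2 * -((m + 1) / 2 + 1) = -m - 1 - 1 - 1 := by ring
    have e2 : 2 * -((m + 2) / 2 + 1) = -m - 1 - 1 - 1 - 1 := by ring
    rw [e0, e1, e2]
    simp only [Real.rpow_sub_one hx.ne']
    have e3 : ‖x‖ ^ (-2 : ℝ) = 1 / ‖x‖ ^ 2 := by
      rw [Real.rpow_neg hx.le]; norm_num
    have e4 : (n : ℝ) * ((n : ℝ) + 2) / 4 = (m + 1) * (m + 2) := by rw [hm]; ring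
    rw [e3, e4, he]
    change _ + (m + 1) * (m + 2) * _ * X (-Real.log ‖x‖) * _ < 0
    change δ * (_ * (0 * 1 ^ 2 * ‖x‖ ^ 2 * φ (-Real.log ‖x‖) + 1 * ((_ * φ (-Real.log ‖x‖)) - _))) + _ - _ + _ < 0
    have h1 := hθ x hx
    have h2 : 0 ≤ (inner ℝ e x : ℝ) / ‖x‖ := by positivity
    have hpθ : (inner ℝ e x : ℝ) = (inner ℝ e x : ℝ) / ‖x‖ * ‖x‖ := by field_simp
    set θ := (inner ℝ e x : ℝ) / ‖x‖ with hθdef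
    rw [hpθ]
    have hk1 : κ0 ≤ κ0 / ψ (-Real.log ‖x‖) ^ 2 := by
      have h7 := h01 (-Real.log ‖x‖)
      rw [le_div_iff₀ (pow_pos h7.1 2)]
      exact mul_le_of_le_one_right hκ0p.le (pow_le_one₀ h7.1.le h7.2.le)
    set κ := κ0 / ψ (-Real.log ‖x‖) ^ 2
    have hf0 := hφ0 (-Real.log ‖x‖)
    have h5 : 0 < ‖x‖ ^ (-m) := Real.rpow_pos_of_pos hx _
    have main : -κ * δ - κ * θ + B * (2 * m + 3 + κ) * θ ^ 2 < 0 := by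
      have a1 : B * (2 * m + 3 + κ) ≤ κ := by
        have : B * κ ≤ 1 / 2 * κ := mul_le_mul_of_nonneg_right hB1 (by linarith)
        linarith
      have a2 : B * (2 * m + 3 + κ) * θ ^ 2 ≤ κ * θ := by
        have : θ ^ 2 ≤ θ := by nlinarith
        have : 0 ≤ κ := by linarith
        calc _ ≤ κ * θ ^ 2 := by gcongr
          _ ≤ _ := by gcongr
      have a3 : 0 < κ * δ := by
        have : 0 < κ := by linarith
        positivity
      linarith
    have hneg := mul_neg_of_pos_of_neg (div_pos (mul_pos h5 hf0) (pow_pos hx 2)) main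
    refine lt_of_eq_of_lt ?_ hneg
    simp only [hφ]
    clear_value κ θ
    rw [hB]
    field_simp
    ring

lemma refl_le {n : ℕ} (m : ℝ) (hm0 : 0 < m) (hm : (n : ℝ) = 2 * m + 2) {ψ : ℝ → ℝ} {T : ℝ}
    (hψ : IsStdRadial n ψ T) (μ : ℝ) (hμ : 0 < μ) (r₀ : ℝ) (W : E n → ℝ)
    (hWc : ContinuousOn W {x : E n | 0 < ‖x‖ ∧ ‖x‖ ≤ r₀})
    (hWd : ∀ x : E n, 0 < ‖x‖ → ‖x‖ < r₀ → ContDiffAt ℝ 2 W x)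
    (hWe : ∀ x : E n, 0 < ‖x‖ → ‖x‖ < r₀ → linYamabe n ψ W x = 0)
    (hWb : ∀ x : E n, ‖x‖ = r₀ → W x = 0) (C : ℝ)
    (hdec : ∀ x : E n, 0 < ‖x‖ → ‖x‖ ≤ r₀ → |W x| ≤ C * ‖x‖ ^ (μ - m))
    (a b : E n) (hab : ‖a‖ = ‖b‖) (ha0 : 0 < ‖a‖) (ha1 : ‖a‖ < r₀) : W a ≤ W b := by
  by_contra hcon
  push Not at hcon
  have hne : a - b ≠ 0 := by
    intro h
    rw [sub_eq_zero.1 h] at hcon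
    exact lt_irrefl _ hcon
  have hv : 0 < ‖a - b‖ := norm_pos_iff.2 hne
  set R : E n ≃ₗᵢ[ℝ] E n := Submodule.reflection (Submodule.span ℝ {a - b})ᗮ with hR
  have hRa : R a = b := Submodule.reflection_sub hab
  set e : E n := ‖a - b‖⁻¹ • (a - b) with he
  have he1 : ‖e‖ = 1 := by
    rw [he, norm_smul, norm_inv, norm_norm, inv_mul_cancel₀ hv.ne']
  have hRe : ∀ x : E n, (inner ℝ e x : ℝ) = 0 → R x = x := by
    intro x hx
    apply Submodule.reflection_mem_subspace_eq_self
    rw [Submodule.mem_orthogonal_singleton_iff_inner_right]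
    rw [he, inner_smul_left] at hx
    simpa [hv.ne', sub_eq_zero] using hx
  have hea : 0 ≤ (inner ℝ e a : ℝ) := by
    rw [he, inner_smul_left, inner_sub_left, real_inner_self_eq_norm_sq]
    have h1 : (inner ℝ b a : ℝ) ≤ ‖a‖ ^ 2 := by
      have := real_inner_le_norm b a
      rw [← hab] at this
      linarith [this, sq ‖a‖]
    apply mul_nonneg
    · simp
    · linarith
  obtain ⟨G, c0, hc0, hGd, hGl, hGs⟩ := barrier m hm0 hm hψ e he1
  set V : E n → ℝ := fun y => W y - W (R y) with hV
  have hVd : ∀ x : E n, 0 < ‖x‖ → ‖x‖ < r₀ → ContDiffAt ℝ 2 V x := by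
    intro x h0 h1
    refine (hWd x h0 h1).sub ?_
    exact ContDiffAt.comp (g := W) (f := R) x (hWd _ (by simpa using h0) (by simpa using h1))
      R.contDiff.contDiffAt
  have hVe : ∀ x : E n, 0 < ‖x‖ → ‖x‖ < r₀ → linYamabe n ψ V x = 0 := by
    intro x h0 h1
    have h2 : ContDiffAt ℝ 2 W (R x) := hWd _ (by simpa using h0) (by simpa using h1)
    have h3 : ContDiffAt ℝ 2 (fun y => W (R y)) x :=
      ContDiffAt.comp (g := W) (f := R) x h2 R.contDiff.contDiffAt
    have e1 := hWe x h0 h1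
    have e2 := hWe (R x) (by simpa using h0) (by simpa using h1)
    unfold linYamabe at e1 e2 ⊢
    rw [hV, lap_sub' (hWd x h0 h1) h3, lap_comp_isometry R h2]
    rw [R.norm_map] at e2
    linear_combination e1 - e2
  have hVdec : ∀ x : E n, 0 < ‖x‖ → ‖x‖ ≤ r₀ → V x ≤ 2 * C * ‖x‖ ^ (μ - m) := by
    intro x h0 h1
    have e1 := hdec x h0 h1
    have e2 := hdec (R x) (by simpa using h0) (by simpa using h1)
    rw [R.norm_map] at e2
    have := abs_le.1 e1
    have := abs_le.1 e2
    simp only [hV]; linarith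
  have hGpos : ∀ x : E n, 0 < ‖x‖ → 0 ≤ (inner ℝ e x : ℝ) → 0 < G x := by
    intro x h0 h1
    have := hGl x h0 h1
    have : 0 < c0 * ‖x‖ ^ (-m) := mul_pos hc0 (Real.rpow_pos_of_pos h0 _)
    linarith
  have hVa : 0 < V a := by simp only [hV, hRa]; linarith
  set ε := V a / G a with hε
  have hGa := hGpos a ha0 hea
  have hε0 : 0 < ε := div_pos hVa hGa
  have htend : Tendsto (fun r : ℝ => 2 * C * r ^ μ) (𝓝 0) (𝓝 0) := by
    have := ((Real.continuousAt_rpow_const 0 μ (Or.inr hμ.le)).const_mul (2 * C)).tendsto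
    simpa [Real.zero_rpow hμ.ne'] using this
  obtain ⟨ρ, hρ, hρ'⟩ := Metric.eventually_nhds_iff.1
    (htend.eventually (gt_mem_nhds (mul_pos hε0 hc0)))
  have hsmall : ∀ x : E n, 0 < ‖x‖ → ‖x‖ ≤ r₀ → 0 ≤ (inner ℝ e x : ℝ) → ‖x‖ < ρ →
      V x / G x < ε := by
    intro x h0 h1 h2 h3
    have h4 := hρ' (y := ‖x‖) (by simpa using h3)
    rw [div_lt_iff₀ (hGpos x h0 h2)]
    have h5 : 0 < ‖x‖ ^ (-m) := Real.rpow_pos_of_pos h0 _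
    calc V x ≤ 2 * C * ‖x‖ ^ (μ - m) := hVdec x h0 h1
      _ = (2 * C * ‖x‖ ^ μ) * ‖x‖ ^ (-m) := by
        rw [sub_eq_add_neg, Real.rpow_add h0]; ring
      _ < (ε * c0) * ‖x‖ ^ (-m) := by gcongr
      _ = ε * (c0 * ‖x‖ ^ (-m)) := by ring
      _ ≤ ε * G x := by gcongr; exact hGl x h0 h2
  set ρ1 := min ρ ‖a‖ with hρ1
  have hρ10 : 0 < ρ1 := lt_min hρ ha0
  set K : Set (E n) := {x | ρ1 ≤ ‖x‖ ∧ ‖x‖ ≤ r₀ ∧ 0 ≤ (inner ℝ e x : ℝ)} with hK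
  have hKi : IsClosed {x : E n | 0 ≤ (inner ℝ e x : ℝ)} :=
    isClosed_le continuous_const (by fun_prop)
  have hKc : IsCompact K := by
    apply (isCompact_closedBall (0 : E n) r₀).of_isClosed_subset
    · refine (isClosed_le continuous_const continuous_norm).inter
        ((isClosed_le continuous_norm continuous_const).inter hKi)
    · intro x hx
      simpa using hx.2.1
  have haK : a ∈ K := ⟨min_le_right _ _, ha1.le, hea⟩
  have hQc : ContinuousOn (fun x => V x / G x) K := by
    intro x hx
    have hx0 : 0 < ‖x‖ := lt_of_lt_of_le hρ10 hx.1
    have hsub : K ⊆ {x : E n | 0 < ‖x‖ ∧ ‖x‖ ≤ r₀} := fun y hy =>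
      ⟨lt_of_lt_of_le hρ10 hy.1, hy.2.1⟩
    have hW1 : ContinuousOn (fun y => W (R y)) K :=
      hWc.comp R.continuous.continuousOn (fun y hy => by
        have := hsub hy
        simpa using this)
    exact (((hWc.mono hsub) x hx).sub (hW1 x hx)).div
      (hGd x hx0).continuousAt.continuousWithinAt (hGpos x hx0 hx.2.2).ne'
  obtain ⟨z, hzK, hz⟩ := hKc.exists_isMaxOn ⟨a, haK⟩ hQc
  have hz0 : 0 < ‖z‖ := lt_of_lt_of_le hρ10 hzK.1
  have hGz := hGpos z hz0 hzK.2.2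
  set lam := V z / G z with hlam
  have hlamε : ε ≤ lam := hz haK
  have hlam0 : 0 < lam := lt_of_lt_of_le hε0 hlamε
  have hVz : V z = lam * G z := by rw [hlam]; field_simp
  have hVz0 : 0 < V z := by rw [hVz]; positivity
  have hze : 0 < (inner ℝ e z : ℝ) := by
    rcases hzK.2.2.lt_or_eq with h | h
    · exact h
    · have := hRe z h.symm
      simp only [hV, this] at hVz0
      simp at hVz0
  have hzr : ‖z‖ < r₀ := by
    rcases hzK.2.1.lt_or_eq with h | h
    · exact h
    · have h1 := hWb z h
      have h2 := hWb (R z) (by simpa using h)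
      simp only [hV, h1, h2] at hVz0
      simp at hVz0
  have hloc : IsLocalMax (fun y => V y - lam * G y) z := by
    have o1 : ∀ᶠ y : E n in 𝓝 z, 0 < ‖y‖ := continuous_norm.continuousAt.eventually (lt_mem_nhds hz0)
    have o2 : ∀ᶠ y : E n in 𝓝 z, ‖y‖ < r₀ := continuous_norm.continuousAt.eventually (gt_mem_nhds hzr)
    have o3 : ∀ᶠ y : E n in 𝓝 z, 0 < (inner ℝ e y : ℝ) :=
      (show Continuous fun y : E n => (inner ℝ e y : ℝ) by fun_prop).continuousAt.eventually
        (lt_mem_nhds hze)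
    filter_upwards [o1, o2, o3] with y h1 h2 h3
    have hq : V y / G y ≤ lam := by
      by_cases hy : ρ1 ≤ ‖y‖
      · exact hz (show y ∈ K from ⟨hy, h2.le, h3.le⟩)
      · push Not at hy
        exact (hsmall y h1 h2.le h3.le (lt_of_lt_of_le hy (min_le_left _ _))).le.trans hlamε
    rw [div_le_iff₀ (hGpos y h1 h3.le)] at hq
    rw [hVz]
    linarith
  have hlap := lap_nonpos_of_isLocalMax
    ((hVd z hz0 hzr).sub (contDiffAt_const.mul (hGd z hz0))) hloc
  rw [lap_sub' (hVd z hz0 hzr) (contDiffAt_const.mul (hGd z hz0)), lap_smul' _ (hGd z hz0)] at hlap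
  have e1 := hVe z hz0 hzr
  have e2 := hGs z hz0 hze.le
  unfold linYamabe at e1 e2
  rw [hVz] at e1
  have e3 := mul_neg_of_pos_of_neg hlam0 e2
  linarith

lemma ode_unique_zero (P : ℝ → ℝ) (M : ℝ) (hP : ∀ t, |P t| ≤ M) (w w' : ℝ → ℝ) (t0 t1 : ℝ)
    (ht : t0 < t1) (hw : ∀ t, t0 < t → HasDerivAt w (w' t) t)
    (hw' : ∀ t, t0 < t → HasDerivAt w' (-(P t) * w t) t) (h0 : w t1 = 0) (h1 : w' t1 = 0) :
    ∀ t, t0 < t → w t = 0 := by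
  intro t htt
  set b := max t t1 + 1 with hb
  have hbt : t < b := by have := le_max_left t t1; linarith
  have hbt1 : t1 < b := by have := le_max_right t t1; linarith
  set v : ℝ → ℝ × ℝ → ℝ × ℝ := fun t p => (p.2, -(P t) * p.1) with hv
  have hL : ∀ t ∈ Set.Ioo t0 b, LipschitzOnWith (Real.toNNReal (max 1 M)) (v t) Set.univ := by
    intro s _
    apply LipschitzWith.lipschitzOnWith
    apply LipschitzWith.of_dist_le_mul
    intro x y
    have hc : ((Real.toNNReal (max 1 M) : NNReal) : ℝ) = max 1 M :=
      Real.coe_toNNReal _ (le_trans zero_le_one (le_max_left _ _))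
    rw [hc]
    simp only [hv]
    rw [Prod.dist_eq, Prod.dist_eq]
    have hM0 : (0:ℝ) ≤ max 1 M := le_trans zero_le_one (le_max_left _ _)
    apply max_le
    · calc dist x.2 y.2 ≤ max (dist x.1 y.1) (dist x.2 y.2) := le_max_right _ _
        _ = 1 * max (dist x.1 y.1) (dist x.2 y.2) := (one_mul _).symm
        _ ≤ _ := by gcongr; exact le_max_left _ _
    · simp only [Real.dist_eq]
      rw [← mul_sub, abs_mul, abs_neg]
      apply mul_le_mul ((hP s).trans (le_max_right _ _)) (le_max_left _ _) (abs_nonneg _) hM0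
  have hf : ∀ s ∈ Set.Ioo t0 b, HasDerivAt (fun s => (w s, w' s)) (v s (w s, w' s)) s ∧
      (fun s => (w s, w' s)) s ∈ (Set.univ : Set (ℝ × ℝ)) := fun s hs =>
    ⟨(hw s hs.1).prodMk (hw' s hs.1), trivial⟩
  have hg : ∀ s ∈ Set.Ioo t0 b, HasDerivAt (fun _ : ℝ => ((0:ℝ), (0:ℝ))) (v s (0, 0)) s ∧
      (fun _ : ℝ => ((0:ℝ), (0:ℝ))) s ∈ (Set.univ : Set (ℝ × ℝ)) := fun s hs =>
    ⟨by
      have : v s (0, 0) = 0 := by simp [hv]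
      rw [this]
      exact hasDerivAt_const s _, trivial⟩
  have := ODE_solution_unique_of_mem_Ioo (s := fun _ => Set.univ) hL (t₀ := t1) ⟨ht, hbt1⟩ hf hg
    (by simp [h0, h1])
  have h2 := this (show t ∈ Set.Ioo t0 b from ⟨htt, hbt⟩)
  exact congrArg Prod.fst h2

lemma const_of_tendsto (D : ℝ → ℝ) (t0 : ℝ) (h : ∀ t, t0 < t → HasDerivAt D 0 t)
    (hl : Tendsto D atTop (𝓝 0)) : ∀ t, t0 < t → D t = 0 := by
  intro t ht
  have hc : ∀ s, t0 < s → D s = D t := by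
    intro s hs
    apply (isOpen_Ioi (a := t0)).is_const_of_deriv_eq_zero isPreconnected_Ioi
      (fun x hx => (h x hx).differentiableAt.differentiableWithinAt) _ hs ht
    intro x hx
    exact (h x hx).deriv
  have : D =ᶠ[atTop] fun _ => D t := by
    filter_upwards [eventually_gt_atTop t0] with s hs using hc s hs
  exact tendsto_nhds_unique (tendsto_const_nhds.congr' this.symm) hl

lemma ode_zero {n : ℕ} (m : ℝ) (hm0 : 0 < m) (hm : (n : ℝ) = 2 * m + 2) {ψ : ℝ → ℝ} {T : ℝ}
    (hψ : IsStdRadial n ψ T) (w w' : ℝ → ℝ) (t0 : ℝ)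
    (hw : ∀ t, t0 < t → HasDerivAt w (w' t) t)
    (hw' : ∀ t, t0 < t → HasDerivAt w'
      (-((m + 1) * (m + 2) * ψ t ^ ((4 : ℝ) / ((n : ℝ) - 2)) - m ^ 2) * w t) t)
    (hl : Tendsto w atTop (𝓝 0)) (hl' : Tendsto w' atTop (𝓝 0)) : ∀ t, t0 < t → w t = 0 := by
  obtain ⟨hd1, hd2, hd3, h, hh, hH⟩ := psi_facts m hm0 hm hψ
  obtain ⟨hsm, hT, hper, h01, hode⟩ := hψ
  have hq : 0 < (4 : ℝ) / ((n : ℝ) - 2) := by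
    rw [hm]; apply div_pos <;> linarith
  set X : ℝ → ℝ := fun t => ψ t ^ ((4 : ℝ) / ((n : ℝ) - 2)) with hX
  have hX0 : ∀ t, 0 < X t := fun t => Real.rpow_pos_of_pos (h01 t).1 _
  have hX1 : ∀ t, X t < 1 := fun t => Real.rpow_lt_one (h01 t).1.le (h01 t).2 hq
  set P : ℝ → ℝ := fun t => (m + 1) * (m + 2) * X t - m ^ 2 with hPdef
  have hP : ∀ t, |P t| ≤ (m + 1) * (m + 2) + m ^ 2 := by
    intro t
    have h0 := hX0 t
    have h1 := hX1 t
    have h2 : 0 < (m + 1) * (m + 2) * X t := by positivity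
    have h3 : (m + 1) * (m + 2) * X t ≤ (m + 1) * (m + 2) :=
      mul_le_of_le_one_right (by positivity) h1.le
    rw [abs_le]
    constructor <;> simp only [hPdef] <;> nlinarith
  set g := deriv ψ with hg
  set g1 : ℝ → ℝ := fun t => m ^ 2 * ψ t - m * (m + 1) * (ψ t * X t) with hg1
  have hg' : ∀ t, HasDerivAt g (g1 t) t := hd2
  have hg1' : ∀ t, HasDerivAt g1 (-(P t) * g t) t := by
    intro t
    have h1 := ((hd1 t).const_mul (m ^ 2)).sub (((hd1 t).mul (hd3 t)).const_mul (m * (m + 1)))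
    convert! h1 using 1
    have := (h01 t).1.ne'
    simp only [hPdef, hX]
    field_simp
    ring
  have hgb : ∀ t, |g t| ≤ m := by
    intro t
    apply abs_le_of_sq_le_sq _ hm0.le
    have h1 := hH t
    have h2 : 0 ≤ m ^ 2 * (ψ t ^ 2 * X t) := by have := hX0 t; positivity
    have h3 : 0 < m ^ 2 * h := by positivity
    have h4 : ψ t ^ 2 ≤ 1 := pow_le_one₀ (h01 t).1.le (h01 t).2.le
    have h5 : m ^ 2 * ψ t ^ 2 ≤ m ^ 2 := mul_le_of_le_one_right (by positivity) h4
    have h6 : m ^ 2 * (ψ t ^ 2 - ψ t ^ 2 * X t) - g t ^ 2 = m ^ 2 * h := h1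
    nlinarith
  have hg1b : ∀ t, |g1 t| ≤ m ^ 2 + m * (m + 1) := by
    intro t
    have a0 := (h01 t).1
    have a1 := (h01 t).2
    have b0 := hX0 t
    have b1 := hX1 t
    have c1 : ψ t * X t ≤ 1 := mul_le_one₀ a1.le b0.le b1.le
    have d1 : m ^ 2 * ψ t ≤ m ^ 2 := mul_le_of_le_one_right (by positivity) a1.le
    have d2 : m * (m + 1) * (ψ t * X t) ≤ m * (m + 1) := mul_le_of_le_one_right (by positivity) c1
    have d3 : 0 < m ^ 2 * ψ t := by positivity
    have d4 : 0 < m * (m + 1) * (ψ t * X t) := by positivity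
    rw [abs_le]
    constructor <;> simp only [hg1] <;> nlinarith
  have hD : ∀ t, t0 < t → w' t * g t - w t * g1 t = 0 := by
    apply const_of_tendsto
    · intro t ht
      have := ((hw' t ht).mul (hg' t)).sub ((hw t ht).mul (hg1' t))
      convert! this using 1
      simp only [hPdef, hX]
      ring
    · have t1 : Tendsto (fun t => w' t * g t) atTop (𝓝 0) :=
        hl'.zero_mul_isBoundedUnder_le ⟨m, by simpa using ⟨0, fun t _ => hgb t⟩⟩
      have t2 : Tendsto (fun t => w t * g1 t) atTop (𝓝 0) :=
        hl.zero_mul_isBoundedUnder_le ⟨_, by simpa using ⟨0, fun t _ => hg1b t⟩⟩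
      simpa using t1.sub t2
  by_cases hcase : ∃ t1, t0 < t1 ∧ g t1 ≠ 0
  · obtain ⟨t1, ht1, hgt1⟩ := hcase
    set c := w t1 / g t1 with hc
    have hz := ode_unique_zero P _ hP (fun t => w t - c * g t) (fun t => w' t - c * g1 t) t0 t1 ht1
      (fun t ht => (hw t ht).sub ((hg' t).const_mul c))
      (fun t ht => by
        have := (hw' t ht).sub ((hg1' t).const_mul c)
        convert! this using 1
        simp only [hPdef, hX]
        ring)
      (by simp only [hc]; field_simp; ring)
      (by
        have := hD t1 ht1
        simp only [hc]
        field_simp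
        linear_combination this)
    have hgper : ∀ k : ℕ, g (t1 + k * T) = g t1 := by
      intro k
      have hp : Function.Periodic g T := by
        intro x
        have h1 : (fun y => ψ (y + T)) = ψ := funext hper
        rw [hg, ← deriv_comp_add_const, h1]
      exact hp.nat_mul k t1
    have hlim : Tendsto (fun k : ℕ => t1 + k * T) atTop atTop :=
      tendsto_atTop_add_const_left _ _ (tendsto_natCast_atTop_atTop.atTop_mul_const hT)
    have h3 := hl.comp hlim
    have h4 : (w ∘ fun k : ℕ => t1 + k * T) = fun _ => c * g t1 := by
      funext k
      have : t0 < t1 + k * T := by have : 0 ≤ (k:ℝ) * T := by positivity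
                                   linarith
      have := hz _ this
      simp only [hgper] at this
      simp only [Function.comp]
      linarith
    rw [h4] at h3
    have h5 : c * g t1 = 0 := tendsto_nhds_unique tendsto_const_nhds h3
    have hc0 : c = 0 := by
      rcases mul_eq_zero.1 h5 with h | h
      · exact h
      · exact absurd h hgt1
    intro t ht
    have := hz t ht
    simpa [hc0] using this
  · push Not at hcase
    have hPc : ∀ t, t0 < t → P t = 2 * m := by
      intro t ht
      have e1 : g =ᶠ[𝓝 t] fun _ => 0 := by
        filter_upwards [lt_mem_nhds ht] with s hs using hcase s hs
      have e2 : g1 t = 0 := by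
        rw [← (hg' t).deriv, e1.deriv_eq]; simp
      have e3 : m * ψ t * (m - (m + 1) * X t) = 0 := by
        simp only [hg1] at e2; linear_combination e2
      have e4 : m - (m + 1) * X t = 0 := by
        rcases mul_eq_zero.1 e3 with h | h
        · have := (h01 t).1
          have : 0 < m * ψ t := by positivity
          linarith
        · exact h
      simp only [hPdef]
      linear_combination (-(m + 2)) * e4
    have hE : ∀ t, t0 < t → w' t ^ 2 + 2 * m * w t ^ 2 = 0 := by
      apply const_of_tendsto
      · intro t ht
        have := ((hw' t ht).pow 2).add (((hw t ht).pow 2).const_mul (2 * m))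
        convert! this using 1
        have h2 : (m + 1) * (m + 2) * X t - m ^ 2 = 2 * m := hPc t ht
        simp only [hX] at h2
        rw [h2]
        simp
        ring
      · simpa using (hl'.pow 2).add ((hl.pow 2).const_mul (2 * m))
    intro t ht
    have h1 := hE t ht
    have h2 : w t ^ 2 = 0 := by nlinarith [sq_nonneg (w' t), sq_nonneg (w t)]
    simpa using h2

lemma radial_zero {n : ℕ} (m : ℝ) (hm0 : 0 < m) (hm : (n : ℝ) = 2 * m + 2) {ψ : ℝ → ℝ} {T : ℝ}
    (hψ : IsStdRadial n ψ T) (μ : ℝ) (hμ : 0 < μ) (r₀ : ℝ) (hr₀ : 0 < r₀) (W : E n → ℝ)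
    (hWd : ∀ x : E n, 0 < ‖x‖ → ‖x‖ < r₀ → ContDiffAt ℝ 2 W x)
    (hWe : ∀ x : E n, 0 < ‖x‖ → ‖x‖ < r₀ → linYamabe n ψ W x = 0)
    (C : ℝ)
    (hdec : ∀ x : E n, 0 < ‖x‖ → ‖x‖ < r₀ → |W x| ≤ C * ‖x‖ ^ (μ - m))
    (hdec' : ∀ x : E n, 0 < ‖x‖ → ‖x‖ < r₀ → ‖fderiv ℝ W x‖ ≤ C * ‖x‖ ^ (μ - m - 1))
    (hrad : ∀ a b : E n, ‖a‖ = ‖b‖ → 0 < ‖a‖ → ‖a‖ < r₀ → W a = W b) :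
    ∀ x : E n, 0 < ‖x‖ → ‖x‖ < r₀ → W x = 0 := by
  intro x hx0 hx1
  set e : E n := ‖x‖⁻¹ • x with he
  have he1 : ‖e‖ = 1 := by
    rw [he, norm_smul, norm_inv, norm_norm, inv_mul_cancel₀ hx0.ne']
  set t0 := -Real.log r₀ with ht0
  have hexp : ∀ t, t0 < t → Real.exp (-t) < r₀ := by
    intro t ht
    rw [← Real.lt_log_iff_exp_lt hr₀]; linarith
  have hnorm : ∀ t : ℝ, ‖Real.exp (-t) • e‖ = Real.exp (-t) := by
    intro t
    rw [norm_smul, he1, mul_one, Real.norm_eq_abs, abs_of_pos (Real.exp_pos _)]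
  set η : ℝ → ℝ := fun t => Real.exp (-(m * t)) * W (Real.exp (-t) • e) with hη
  have hWt : ∀ t, t0 < t → ContDiffAt ℝ 2 W (Real.exp (-t) • e) := fun t ht =>
    hWd _ (by rw [hnorm]; exact Real.exp_pos _) (by rw [hnorm]; exact hexp t ht)
  have hηc : ∀ t, t0 < t → ContDiffAt ℝ 2 η t := by
    intro t ht
    have h1 : ContDiffAt ℝ 2 (fun t : ℝ => Real.exp (-t) • e) t := by fun_prop
    have h2 : ContDiffAt ℝ 2 (fun t : ℝ => Real.exp (-(m * t))) t := by fun_prop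
    exact h2.mul (ContDiffAt.comp (g := W) t (hWt t ht) h1)
  have hη1 : ∀ t, t0 < t → HasDerivAt η (deriv η t) t := fun t ht =>
    ((hηc t ht).differentiableAt (by norm_num)).hasDerivAt
  have hη2 : ∀ t, t0 < t → HasDerivAt (deriv η) (deriv (deriv η) t) t := by
    intro t ht
    have : ContDiffAt ℝ 1 (deriv η) t := by
      have h3 : ContDiffAt ℝ 1 (fun s => fderiv ℝ η s 1) t :=
        ((hηc t ht).fderiv_right (m := 1) (by norm_num)).clm_apply contDiffAt_const
      simpa using h3
    exact (this.differentiableAt (by norm_num)).hasDerivAt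
  have hval : ∀ y : E n, 0 < ‖y‖ → ‖y‖ < r₀ →
      W y = 1 * ((‖y‖ ^ 2) ^ (-((m + 0) / 2)) * η (-(1/2) * Real.log (‖y‖ ^ 2))) := by
    intro y h0 h1
    have hlog : -(1/2) * Real.log (‖y‖ ^ 2) = -Real.log ‖y‖ := by
      rw [Real.log_pow]; push_cast; ring
    have h2 : (‖y‖ ^ 2) ^ (-((m + 0) / 2)) = ‖y‖ ^ (-m) := by
      rw [← Real.rpow_natCast, ← Real.rpow_mul h0.le]; congr 1; push_cast; ring
    have h3 : Real.exp (-(m * -Real.log ‖y‖)) = ‖y‖ ^ m := by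
      rw [Real.rpow_def_of_pos h0]; congr 1; ring
    rw [hlog, h2]
    simp only [hη, h3, neg_neg, Real.exp_log h0]
    have h4 : W (‖y‖ • e) = W y := by
      have : ‖‖y‖ • e‖ = ‖y‖ := by rw [norm_smul, he1, mul_one, norm_norm]
      exact hrad _ _ this (by rw [this]; exact h0) (by rw [this]; exact h1)
    rw [h4, Real.rpow_neg h0.le]
    have := (Real.rpow_pos_of_pos h0 m).ne'
    field_simp
  have hode : ∀ t, t0 < t → deriv (deriv η) t =
      -((m + 1) * (m + 2) * ψ t ^ ((4 : ℝ) / ((n : ℝ) - 2)) - m ^ 2) * η t := by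
    intro t ht
    set y := Real.exp (-t) • e with hy
    have hy0 : 0 < ‖y‖ := by rw [hnorm]; exact Real.exp_pos _
    have hy1 : ‖y‖ < r₀ := by rw [hnorm]; exact hexp t ht
    have hylog : -Real.log ‖y‖ = t := by rw [hnorm, Real.log_exp, neg_neg]
    have hev : W =ᶠ[𝓝 y] fun y : E n => (fun _ : ℝ => (1:ℝ)) (inner ℝ e y) *
        ((‖y‖ ^ 2) ^ (-((m + 0) / 2)) * η (-(1/2) * Real.log (‖y‖ ^ 2))) := by
      have o1 : ∀ᶠ y' : E n in 𝓝 y, 0 < ‖y'‖ :=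
        continuous_norm.continuousAt.eventually (lt_mem_nhds hy0)
      have o2 : ∀ᶠ y' : E n in 𝓝 y, ‖y'‖ < r₀ :=
        continuous_norm.continuousAt.eventually (gt_mem_nhds hy1)
      filter_upwards [o1, o2] with y' h1 h2 using hval y' h1 h2
    have L0 := lap_mode m 0 hm e y hy0 (fun _ => 1) (fun _ => 0) η (deriv η) 0 (deriv (deriv η) t)
      (fun y => hasDerivAt_const y 1) (hasDerivAt_const _ 0) (by simp)
      (by
        rw [hylog]
        filter_upwards [lt_mem_nhds ht] with s hs using hη1 s hs)
      (by rw [hylog]; exact hη2 t ht)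
      (contDiffAt_mode _ e y hy0 _ η contDiff_const (by rw [hylog]; exact hηc t ht))
    rw [← lap_congr' hev] at L0
    have h1 := hWe y hy0 hy1
    unfold linYamabe at h1
    rw [L0, hval y hy0 hy1, hylog] at h1
    have hlog : -(1/2) * Real.log (‖y‖ ^ 2) = t := by
      rw [Real.log_pow, ← hylog]; push_cast; ring
    rw [hlog] at h1
    have hs : 0 < ‖y‖ ^ 2 := by positivity
    have r1 : (‖y‖ ^ 2) ^ (-((m + 0) / 2)) = (‖y‖ ^ 2) ^ (-((m + 0) / 2 + 1)) * ‖y‖ ^ 2 := by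
      rw [← Real.rpow_add_one hs.ne']; congr 1; ring
    have e3 : ‖y‖ ^ (-2 : ℝ) = 1 / ‖y‖ ^ 2 := by
      rw [Real.rpow_neg hy0.le]; norm_num
    have e4 : (n : ℝ) * ((n : ℝ) + 2) / 4 = (m + 1) * (m + 2) := by rw [hm]; ring
    rw [r1, e3, e4] at h1
    have hA : 0 < (‖y‖ ^ 2) ^ (-((m + 0) / 2 + 1)) := Real.rpow_pos_of_pos hs _
    set A := (‖y‖ ^ 2) ^ (-((m + 0) / 2 + 1))
    set Z := ψ t ^ ((4 : ℝ) / ((n : ℝ) - 2))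
    have h2 : A * (deriv (deriv η) t - m ^ 2 * η t + (m + 1) * (m + 2) * Z * η t) = 0 := by
      rw [← h1]
      field_simp
      ring
    rcases mul_eq_zero.1 h2 with h3 | h3
    · exact absurd h3 hA.ne'
    · linear_combination h3
  have hexpμ : Tendsto (fun t : ℝ => Real.exp (-(μ * t))) atTop (𝓝 0) :=
    Real.tendsto_exp_neg_atTop_nhds_zero.comp (tendsto_id.const_mul_atTop hμ)
  have hpw : ∀ t a : ℝ, Real.exp (-t) ^ a = Real.exp (-(t * a)) := by
    intro t a
    rw [← Real.exp_mul]; congr 1; ring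
  have hb : ∀ t, t0 < t → |η t| ≤ C * Real.exp (-(μ * t)) := by
    intro t ht
    have h1 := hdec (Real.exp (-t) • e) (by rw [hnorm]; exact Real.exp_pos _)
      (by rw [hnorm]; exact hexp t ht)
    rw [hnorm, hpw] at h1
    simp only [hη]
    rw [abs_mul, abs_of_pos (Real.exp_pos _)]
    calc _ ≤ Real.exp (-(m * t)) * (C * Real.exp (-(t * (μ - m)))) := by gcongr
      _ = C * (Real.exp (-(m * t)) * Real.exp (-(t * (μ - m)))) := by ring
      _ = _ := by rw [← Real.exp_add]; congr 2; ring
  have hb' : ∀ t, t0 < t → |deriv η t| ≤ (m + 1) * C * Real.exp (-(μ * t)) := by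
    intro t ht
    have h1 : HasDerivAt (fun t : ℝ => Real.exp (-t) • e) ((Real.exp (-t) * (-1)) • e) t :=
      ((hasDerivAt_neg t).exp).smul_const e
    have h2 : HasDerivAt (fun t : ℝ => Real.exp (-(m * t))) (Real.exp (-(m * t)) * (-(m * 1))) t :=
      (((hasDerivAt_id t).const_mul m).neg).exp
    have h3 : HasDerivAt (fun t : ℝ => W (Real.exp (-t) • e))
        (fderiv ℝ W (Real.exp (-t) • e) ((Real.exp (-t) * (-1)) • e)) t :=
      ((hWt t ht).differentiableAt (by norm_num)).hasFDerivAt.comp_hasDerivAt t h1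
    have h4 := (h2.mul h3).deriv
    have h5 : deriv η t = -m * η t +
        Real.exp (-(m * t)) * fderiv ℝ W (Real.exp (-t) • e) ((Real.exp (-t) * (-1)) • e) := by
      refine Eq.trans h4 ?_
      simp only [hη]; ring
    have h6 := hdec' (Real.exp (-t) • e) (by rw [hnorm]; exact Real.exp_pos _)
      (by rw [hnorm]; exact hexp t ht)
    rw [hnorm, hpw] at h6
    have h7 : |fderiv ℝ W (Real.exp (-t) • e) ((Real.exp (-t) * (-1)) • e)| ≤
        C * Real.exp (-(t * (μ - m - 1))) * Real.exp (-t) := by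
      have := (fderiv ℝ W (Real.exp (-t) • e)).le_opNorm ((Real.exp (-t) * (-1)) • e)
      rw [Real.norm_eq_abs] at this
      refine this.trans ?_
      have h8 : ‖(Real.exp (-t) * (-1)) • e‖ = Real.exp (-t) := by
        rw [norm_smul, he1]; simp
      rw [h8]
      gcongr
    rw [h5]
    calc _ ≤ |-m * η t| + |Real.exp (-(m * t)) *
          fderiv ℝ W (Real.exp (-t) • e) ((Real.exp (-t) * (-1)) • e)| := abs_add_le _ _
      _ ≤ m * (C * Real.exp (-(μ * t))) +
          Real.exp (-(m * t)) * (C * Real.exp (-(t * (μ - m - 1))) * Real.exp (-t)) := by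
        have q1 : |-m * η t| ≤ m * (C * Real.exp (-(μ * t))) := by
          rw [abs_mul (-m) (η t), abs_neg, abs_of_pos hm0]
          exact mul_le_mul_of_nonneg_left (hb t ht) hm0.le
        have q2 : |Real.exp (-(m * t)) *
            fderiv ℝ W (Real.exp (-t) • e) ((Real.exp (-t) * (-1)) • e)| ≤
            Real.exp (-(m * t)) * (C * Real.exp (-(t * (μ - m - 1))) * Real.exp (-t)) := by
          rw [abs_mul, abs_of_pos (Real.exp_pos _)]
          exact mul_le_mul_of_nonneg_left h7 (Real.exp_pos _).le
        exact add_le_add q1 q2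
      _ = m * (C * Real.exp (-(μ * t))) +
          C * (Real.exp (-(m * t)) * Real.exp (-(t * (μ - m - 1))) * Real.exp (-t)) := by ring
      _ = _ := by
        rw [← Real.exp_add, ← Real.exp_add]
        have : -(m * t) + -(t * (μ - m - 1)) + -t = -(μ * t) := by ring
        rw [this]; ring
  have hl : Tendsto η atTop (𝓝 0) := by
    apply squeeze_zero_norm' (a := fun t => C * Real.exp (-(μ * t)))
    · filter_upwards [eventually_gt_atTop t0] with t ht using hb t ht
    · simpa using hexpμ.const_mul C
  have hl' : Tendsto (deriv η) atTop (𝓝 0) := by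
    apply squeeze_zero_norm' (a := fun t => (m + 1) * C * Real.exp (-(μ * t)))
    · filter_upwards [eventually_gt_atTop t0] with t ht using hb' t ht
    · simpa using hexpμ.const_mul ((m + 1) * C)
  have hz := ode_zero m hm0 hm hψ η (deriv η) t0 hη1
    (fun t ht => by rw [← hode t ht]; exact hη2 t ht) hl hl'
  rw [hval x hx0 hx1]
  have hlog : -(1/2) * Real.log (‖x‖ ^ 2) = -Real.log ‖x‖ := by
    rw [Real.log_pow]; push_cast; ring
  rw [hlog, hz]
  · ring
  · rw [ht0]
    have := Real.log_lt_log hx0 hx1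
    linarith

/-- Uniqueness of exponentially decaying solutions of the linearized
Yamabe equation with the same Dirichlet data. -/
theorem uniqueness_linearized_weighted
    (n : ℕ) (hn : 3 ≤ n) (ψ : ℝ → ℝ) (T : ℝ) (hψ : IsStdRadial n ψ T)
    (μ : ℝ) (hμ : 1 < μ) (r₀ : ℝ) (hr₀ : 0 < r₀) (hr₀1 : r₀ ≤ 1)
    (F : E n → ℝ) (hF : ContinuousOn F (ball (0 : E n) r₀ \ {0}))
    (W₁ W₂ : E n → ℝ)
    (hW₁ : ContDiffOn ℝ 2 W₁ {x : E n | 0 < ‖x‖ ∧ ‖x‖ ≤ r₀})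
    (hW₂ : ContDiffOn ℝ 2 W₂ {x : E n | 0 < ‖x‖ ∧ ‖x‖ ≤ r₀})
    (heq₁ : ∀ x ∈ ball (0 : E n) r₀ \ {0}, linYamabe n ψ W₁ x = F x)
    (heq₂ : ∀ x ∈ ball (0 : E n) r₀ \ {0}, linYamabe n ψ W₂ x = F x)
    (hbd : ∀ x : E n, ‖x‖ = r₀ → W₁ x = W₂ x)
    (C : ℝ) (hC : 0 < C)
    (hdecay₁ : ∀ j ≤ 2, ∀ x : E n, 0 < ‖x‖ → ‖x‖ ≤ r₀ →
      ‖iteratedFDeriv ℝ j W₁ x‖ ≤ C * ‖x‖ ^ (μ - ((n : ℝ) - 2) / 2 - (j : ℝ)))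
    (hdecay₂ : ∀ j ≤ 2, ∀ x : E n, 0 < ‖x‖ → ‖x‖ ≤ r₀ →
      ‖iteratedFDeriv ℝ j W₂ x‖ ≤ C * ‖x‖ ^ (μ - ((n : ℝ) - 2) / 2 - (j : ℝ))) :
    ∀ x : E n, 0 < ‖x‖ → ‖x‖ ≤ r₀ → W₁ x = W₂ x := by
  set m : ℝ := ((n : ℝ) - 2) / 2 with hmdef
  have hn' : (3 : ℝ) ≤ n := by exact_mod_cast hn
  have hm0 : 0 < m := by rw [hmdef]; linarith
  have hm : (n : ℝ) = 2 * m + 2 := by rw [hmdef]; ring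
  set S : Set (E n) := {x : E n | 0 < ‖x‖ ∧ ‖x‖ ≤ r₀} with hS
  have hnhds : ∀ x : E n, 0 < ‖x‖ → ‖x‖ < r₀ → S ∈ 𝓝 x := by
    intro x h0 h1
    have o1 : ∀ᶠ y : E n in 𝓝 x, 0 < ‖y‖ :=
      continuous_norm.continuousAt.eventually (lt_mem_nhds h0)
    have o2 : ∀ᶠ y : E n in 𝓝 x, ‖y‖ < r₀ :=
      continuous_norm.continuousAt.eventually (gt_mem_nhds h1)
    filter_upwards [o1, o2] with y h2 h3 using ⟨h2, h3.le⟩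
  have hd₁ : ∀ x : E n, 0 < ‖x‖ → ‖x‖ < r₀ → ContDiffAt ℝ 2 W₁ x := fun x h0 h1 =>
    hW₁.contDiffAt (hnhds x h0 h1)
  have hd₂ : ∀ x : E n, 0 < ‖x‖ → ‖x‖ < r₀ → ContDiffAt ℝ 2 W₂ x := fun x h0 h1 =>
    hW₂.contDiffAt (hnhds x h0 h1)
  set W : E n → ℝ := fun y => W₁ y - W₂ y with hW
  have hWd : ∀ x : E n, 0 < ‖x‖ → ‖x‖ < r₀ → ContDiffAt ℝ 2 W x := fun x h0 h1 =>
    (hd₁ x h0 h1).sub (hd₂ x h0 h1)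
  have hWe : ∀ x : E n, 0 < ‖x‖ → ‖x‖ < r₀ → linYamabe n ψ W x = 0 := by
    intro x h0 h1
    have hmem : x ∈ ball (0 : E n) r₀ \ {0} := by
      refine ⟨by simpa using h1, ?_⟩
      simpa using norm_pos_iff.1 h0
    have e1 := heq₁ x hmem
    have e2 := heq₂ x hmem
    unfold linYamabe at e1 e2 ⊢
    rw [hW, lap_sub' (hd₁ x h0 h1) (hd₂ x h0 h1)]
    linear_combination e1 - e2
  have hWb : ∀ x : E n, ‖x‖ = r₀ → W x = 0 := by
    intro x hx
    simp only [hW, hbd x hx, sub_self]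
  have hdec : ∀ x : E n, 0 < ‖x‖ → ‖x‖ ≤ r₀ → |W x| ≤ (2 * C) * ‖x‖ ^ (μ - m) := by
    intro x h0 h1
    have e1 := hdecay₁ 0 (by norm_num) x h0 h1
    have e2 := hdecay₂ 0 (by norm_num) x h0 h1
    rw [norm_iteratedFDeriv_zero, Real.norm_eq_abs, Nat.cast_zero, sub_zero] at e1 e2
    have := abs_sub (W₁ x) (W₂ x)
    simp only [hW]
    linarith
  have hdec' : ∀ x : E n, 0 < ‖x‖ → ‖x‖ < r₀ →
      ‖fderiv ℝ W x‖ ≤ (2 * C) * ‖x‖ ^ (μ - m - 1) := by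
    intro x h0 h1
    have e1 := hdecay₁ 1 (by norm_num) x h0 h1.le
    have e2 := hdecay₂ 1 (by norm_num) x h0 h1.le
    rw [norm_iteratedFDeriv_one, Nat.cast_one] at e1 e2
    have h3 : fderiv ℝ W x = fderiv ℝ W₁ x - fderiv ℝ W₂ x :=
      fderiv_fun_sub ((hd₁ x h0 h1).differentiableAt (by norm_num))
        ((hd₂ x h0 h1).differentiableAt (by norm_num))
    rw [h3]
    have := norm_sub_le (fderiv ℝ W₁ x) (fderiv ℝ W₂ x)
    linarith
  have hWc : ContinuousOn W S := hW₁.continuousOn.sub hW₂.continuousOn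
  have hμ0 : 0 < μ := by linarith
  have hle := refl_le m hm0 hm hψ μ hμ0 r₀ W hWc hWd hWe hWb (2 * C) hdec
  have hz := radial_zero m hm0 hm hψ μ hμ0 r₀ hr₀ W hWd hWe (2 * C)
    (fun x h0 h1 => hdec x h0 h1.le) hdec'
    (fun a b hab h0 h1 => le_antisymm (hle a b hab h0 h1)
      (hle b a hab.symm (hab ▸ h0) (hab ▸ h1)))
  intro x h0 h1
  rcases h1.lt_or_eq with h | h
  · exact sub_eq_zero.1 (hz x h0 h)
  · exact hbd x h
end
end

section
/- Let n ≥ 3 be an integer, ψ a standard radial factor with period T, d ≥ 1 an integer whose indicial root ρ_d exists, and J ≥ 0 an integer. Then for all smooth T-periodic functions a₀, …, a_J : ℝ → ℝ there exist smooth T-periodic functions c₀, …, c_{J+1} : ℝ → ℝ such that η(t) = ( Σ_{j=0}^{J+1} c_j(t) t^j ) e^{−ρ_d t} satisfies η'' + ( (n(n+2)/4) ψ^{4/(n−2)} − (n−2)²/4 − d(d+n−2) ) η = ( Σ_{j=0}^{J} a_j(t) t^j ) e^{−ρ_d t} for all t ∈ ℝ. -/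
open scoped Topology ENNReal
open Metric Filter MeasureTheory

noncomputable section

theorem aux_int_bound_pos {F : Type*} [NormedAddCommGroup F] [NormedSpace ℝ F] 
    (f : ℝ → F) (C K : ℝ) (hC : 0 ≤ C) (hK : 0 < K)
    (hb : ∀ s, ‖f s‖ ≤ C * Real.exp (K * |s|)) (t : ℝ) (ht : 0 ≤ t) :
    ‖∫ s in (0:ℝ)..t, f s‖ ≤ C / K * Real.exp (K * t) := by
  have h1 : ‖∫ s in (0:ℝ)..t, f s‖ ≤ ∫ s in (0:ℝ)..t, C * Real.exp (K * s) := by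
    apply intervalIntegral.norm_integral_le_of_norm_le ht
    · filter_upwards with s hs
      have := hb s
      rwa [abs_of_pos hs.1] at this
    · exact Continuous.intervalIntegrable (by fun_prop) _ _
  have h2 : ∫ s in (0:ℝ)..t, C * Real.exp (K * s)
      = C / K * Real.exp (K * t) - C / K * Real.exp (K * 0) := by
    apply intervalIntegral.integral_eq_sub_of_hasDerivAt
      (f := fun s => C / K * Real.exp (K * s))
    · intro x _
      have := ((((hasDerivAt_id x).const_mul K).exp).const_mul (C / K))
      refine this.congr_deriv ?_
      simp
      field_simp
    · exact Continuous.intervalIntegrable (by fun_prop) _ _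
  have h3 : 0 ≤ C / K * Real.exp (K * 0) := by positivity
  linarith

theorem aux_int_bound {F : Type*} [NormedAddCommGroup F] [NormedSpace ℝ F] 
    (f : ℝ → F) (C K : ℝ) (hC : 0 ≤ C) (hK : 0 < K)
    (hb : ∀ s, ‖f s‖ ≤ C * Real.exp (K * |s|)) (t : ℝ) :
    ‖∫ s in (0:ℝ)..t, f s‖ ≤ C / K * Real.exp (K * |t|) := by
  rcases le_total 0 t with ht | ht
  · rw [abs_of_nonneg ht]; exact aux_int_bound_pos f C K hC hK hb t ht
  · rw [abs_of_nonpos ht]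
    have := aux_int_bound_pos (fun s => f (-s)) C K hC hK
      (fun s => by simpa using hb (-s)) (-t) (by linarith)
    rw [intervalIntegral.integral_comp_neg] at this
    rw [intervalIntegral.integral_symm, norm_neg]
    simpa using this

theorem aux_global_exists {F : Type*} [NormedAddCommGroup F] [NormedSpace ℝ F] [CompleteSpace F]
    (v : ℝ → F → F) (hv : Continuous (fun p : ℝ × F => v p.1 p.2)) (L B : ℝ) (hL : 0 ≤ L)
    (hB : 0 ≤ B)
    (hlip : ∀ t x y, ‖v t x - v t y‖ ≤ L * ‖x - y‖) (hb : ∀ t, ‖v t 0‖ ≤ B) (x0 : F) :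
    ∃ x : ℝ → F, x 0 = x0 ∧ ∀ t, HasDerivAt x (v t (x t)) t := by
  set K : ℝ := 2 * L + 1 with hKdef
  have hK : 0 < K := by positivity
  have hcont : ∀ z : BoundedContinuousFunction ℝ F,
      Continuous (fun s => v s (Real.exp (K * |s|) • z s)) := by
    intro z
    have : Continuous (fun s : ℝ => (s, Real.exp (K * |s|) • z s)) := by fun_prop
    exact hv.comp this
  have hcI : ∀ z : BoundedContinuousFunction ℝ F,
      Continuous (fun t => ∫ s in (0:ℝ)..t, v s (Real.exp (K * |s|) • z s)) := fun z =>
    intervalIntegral.continuous_primitive (fun a b => (hcont z).intervalIntegrable a b) 0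
  have hbd : ∀ z : BoundedContinuousFunction ℝ F, ∀ s,
      ‖v s (Real.exp (K * |s|) • z s)‖ ≤ (B + L * ‖z‖) * Real.exp (K * |s|) := by
    intro z s
    have h1 := hlip s (Real.exp (K * |s|) • z s) 0
    have h2 := norm_sub_norm_le (v s (Real.exp (K * |s|) • z s)) (v s 0)
    rw [sub_zero, norm_smul, Real.norm_of_nonneg (Real.exp_pos _).le] at h1
    have h3 := hb s
    have h4 : 1 ≤ Real.exp (K * |s|) := Real.one_le_exp (by positivity)
    have h5 := z.norm_coe_le_norm s
    have h6 : L * (Real.exp (K * |s|) * ‖z s‖) ≤ L * (Real.exp (K * |s|) * ‖z‖) := by gcongr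
    nlinarith
  have hΦb : ∀ z : BoundedContinuousFunction ℝ F, ∀ t,
      ‖Real.exp (-(K * |t|)) • (x0 + ∫ s in (0:ℝ)..t, v s (Real.exp (K * |s|) • z s))‖
        ≤ ‖x0‖ + (B + L * ‖z‖) / K := by
    intro z t
    rw [norm_smul, Real.norm_of_nonneg (Real.exp_pos _).le]
    have h1 := aux_int_bound _ _ K (by positivity) hK (hbd z) t
    have h2 := norm_add_le x0 (∫ s in (0:ℝ)..t, v s (Real.exp (K * |s|) • z s))
    have h3 : Real.exp (-(K * |t|)) * Real.exp (K * |t|) = 1 := by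
      rw [← Real.exp_add]; simp
    have h4 : Real.exp (-(K * |t|)) ≤ 1 := Real.exp_le_one_iff.2 (by
      have : 0 ≤ K * |t| := by positivity
      linarith)
    have h5 : Real.exp (-(K * |t|)) * ‖x0‖ ≤ 1 * ‖x0‖ := by gcongr
    calc _ ≤ Real.exp (-(K * |t|)) * (‖x0‖ + (B + L * ‖z‖) / K * Real.exp (K * |t|)) := by
          gcongr; linarith
      _ = Real.exp (-(K * |t|)) * ‖x0‖
          + (B + L * ‖z‖) / K * (Real.exp (-(K * |t|)) * Real.exp (K * |t|)) := by ring
      _ ≤ _ := by rw [h3]; linarith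
  let Φ : BoundedContinuousFunction ℝ F → BoundedContinuousFunction ℝ F := fun z =>
    BoundedContinuousFunction.ofNormedAddCommGroup
      (fun t => Real.exp (-(K * |t|)) • (x0 + ∫ s in (0:ℝ)..t, v s (Real.exp (K * |s|) • z s)))
      (by have := hcI z; fun_prop) _ (hΦb z)
  have hΦ : ContractingWith (1/2 : NNReal) Φ := by
    refine ⟨?_, ?_⟩
    · rw [← NNReal.coe_lt_coe]; norm_num
    · apply LipschitzWith.of_dist_le_mul
      intro z w
      rw [BoundedContinuousFunction.dist_le (by positivity)]
      intro t
      change dist (Real.exp (-(K * |t|)) • (x0 + ∫ s in (0:ℝ)..t, v s (Real.exp (K * |s|) • z s)))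
        (Real.exp (-(K * |t|)) • (x0 + ∫ s in (0:ℝ)..t, v s (Real.exp (K * |s|) • w s))) ≤ _
      rw [dist_eq_norm, ← smul_sub, add_sub_add_left_eq_sub,
        ← intervalIntegral.integral_sub ((hcont z).intervalIntegrable _ _)
          ((hcont w).intervalIntegrable _ _), norm_smul, Real.norm_of_nonneg (Real.exp_pos _).le]
      have h1 := aux_int_bound (fun s => v s (Real.exp (K * |s|) • z s) -
        v s (Real.exp (K * |s|) • w s)) (L * dist z w) K (by positivity) hK (by
          intro s
          refine (hlip _ _ _).trans ?_
          rw [← smul_sub, norm_smul, Real.norm_of_nonneg (Real.exp_pos _).le, ← dist_eq_norm]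
          have := BoundedContinuousFunction.dist_coe_le_dist (f := z) (g := w) s
          calc _ ≤ L * (Real.exp (K * |s|) * dist z w) := by gcongr
            _ = _ := by ring) t
      have h3 : Real.exp (-(K * |t|)) * Real.exp (K * |t|) = 1 := by
        rw [← Real.exp_add]; simp
      calc _ ≤ Real.exp (-(K * |t|)) * (L * dist z w / K * Real.exp (K * |t|)) := by gcongr
        _ = L / K * dist z w * (Real.exp (-(K * |t|)) * Real.exp (K * |t|)) := by ring
        _ = L / K * dist z w := by rw [h3, mul_one]
        _ ≤ _ := by
          have : L / K ≤ 1 / 2 := by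
            rw [div_le_div_iff₀ hK (by norm_num)]; linarith
          have h5 : ((1/2 : NNReal) : ℝ) = 1/2 := by norm_num
          rw [h5]
          gcongr
  obtain ⟨z, hz⟩ : ∃ z, Φ z = z := ⟨_, hΦ.fixedPoint_isFixedPt⟩
  have hz' : ∀ t, Real.exp (K * |t|) • z t
      = x0 + ∫ s in (0:ℝ)..t, v s (Real.exp (K * |s|) • z s) := by
    intro t
    have h0 : Real.exp (-(K * |t|)) • (x0 + ∫ s in (0:ℝ)..t, v s (Real.exp (K * |s|) • z s)) = z t :=
      congrArg (fun g : BoundedContinuousFunction ℝ F => g t) hz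
    have h3 : Real.exp (K * |t|) * Real.exp (-(K * |t|)) = 1 := by
      rw [← Real.exp_add]; simp
    rw [← h0, smul_smul, h3, one_smul, ]
  refine ⟨fun t => Real.exp (K * |t|) • z t, ?_, ?_⟩
  · have h0 := hz' 0
    simpa using h0
  · intro t
    have h1 := ((hcont z).integral_hasStrictDerivAt 0 t).hasDerivAt.const_add x0
    refine h1.congr_of_eventuallyEq (Eventually.of_forall hz')

def AuxSol (ρ : ℝ) (W f y : ℝ → ℝ) : Prop :=
  Differentiable ℝ y ∧ ∀ t, HasDerivAt (deriv y) (2 * ρ * deriv y t - W t * y t + f t) t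

theorem AuxSol.comb {ρ : ℝ} {W f g y z : ℝ → ℝ} (hy : AuxSol ρ W f y) (hz : AuxSol ρ W g z)
    (a b : ℝ) : AuxSol ρ W (fun t => a * f t + b * g t) (fun t => a * y t + b * z t) ∧
      ∀ t, deriv (fun t => a * y t + b * z t) t = a * deriv y t + b * deriv z t := by
  have hd : ∀ t, HasDerivAt (fun t => a * y t + b * z t) (a * deriv y t + b * deriv z t) t :=
    fun t => ((hy.1 t).hasDerivAt.const_mul a).add ((hz.1 t).hasDerivAt.const_mul b)
  have hd' : ∀ t, deriv (fun t => a * y t + b * z t) t = a * deriv y t + b * deriv z t :=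
    fun t => (hd t).deriv
  refine ⟨⟨fun t => (hd t).differentiableAt, fun t => ?_⟩, hd'⟩
  have h2 := ((hy.2 t).const_mul a).add ((hz.2 t).const_mul b)
  rw [hd' t]
  have h3 : deriv (fun t => a * y t + b * z t) = fun t => a * deriv y t + b * deriv z t :=
    funext hd'
  rw [h3]
  refine h2.congr_deriv ?_
  ring

theorem AuxSol.shift {ρ T : ℝ} {W f y : ℝ → ℝ} (hW : Function.Periodic W T)
    (hf : Function.Periodic f T) (hy : AuxSol ρ W f y) :
    AuxSol ρ W f (fun t => y (t + T)) ∧ ∀ t, deriv (fun t => y (t + T)) t = deriv y (t + T) := by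
  have hd : ∀ t, HasDerivAt (fun t => y (t + T)) (deriv y (t + T)) t :=
    fun t => (hy.1 (t + T)).hasDerivAt.comp_add_const t T
  have h3 : deriv (fun t => y (t + T)) = fun t => deriv y (t + T) := funext fun t => (hd t).deriv
  refine ⟨⟨fun t => (hd t).differentiableAt, fun t => ?_⟩, fun t => (hd t).deriv⟩
  rw [h3]
  have h2 := (hy.2 (t + T)).comp_add_const t T
  rw [hW t, hf t] at h2
  exact h2

theorem aux_lip (ρ : ℝ) (W f : ℝ → ℝ) (M : ℝ) (hM : ∀ t, |W t| ≤ M) (t : ℝ) (p q : ℝ × ℝ) :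
    ‖((p.2, 2 * ρ * p.2 - W t * p.1 + f t) : ℝ × ℝ) - (q.2, 2 * ρ * q.2 - W t * q.1 + f t)‖
      ≤ (1 + 2 * |ρ| + M) * ‖p - q‖ := by
  have h1 : |p.1 - q.1| ≤ ‖p - q‖ := norm_fst_le (p - q)
  have h2 : |p.2 - q.2| ≤ ‖p - q‖ := norm_snd_le (p - q)
  have hM0 : 0 ≤ M := (abs_nonneg _).trans (hM t)
  have h0 : 0 ≤ ‖p - q‖ := norm_nonneg _
  have hr := abs_nonneg ρ
  rw [Prod.norm_def]
  apply max_le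
  · change |p.2 - q.2| ≤ _
    nlinarith [mul_nonneg hr h0, mul_nonneg hM0 h0]
  · change |2 * ρ * p.2 - W t * p.1 + f t - (2 * ρ * q.2 - W t * q.1 + f t)| ≤ _
    have e : 2 * ρ * p.2 - W t * p.1 + f t - (2 * ρ * q.2 - W t * q.1 + f t)
      = 2 * ρ * (p.2 - q.2) - W t * (p.1 - q.1) := by ring
    rw [e]
    have h3 := abs_sub (2 * ρ * (p.2 - q.2)) (W t * (p.1 - q.1))
    rw [abs_mul, abs_mul, abs_mul, abs_two] at h3
    have h4 : 2 * |ρ| * |p.2 - q.2| ≤ 2 * |ρ| * ‖p - q‖ := by gcongr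
    have h5 : |W t| * |p.1 - q.1| ≤ M * ‖p - q‖ := mul_le_mul (hM t) h1 (abs_nonneg _) hM0
    linarith

theorem AuxSol.exists {ρ : ℝ} {W f : ℝ → ℝ} (hW : Continuous W) (hf : Continuous f) {M B : ℝ}
    (hM : ∀ t, |W t| ≤ M) (hB : ∀ t, |f t| ≤ B) (a b : ℝ) :
    ∃ y, AuxSol ρ W f y ∧ y 0 = a ∧ deriv y 0 = b := by
  have hM0 : 0 ≤ M := (abs_nonneg _).trans (hM 0)
  have hB0 : 0 ≤ B := (abs_nonneg _).trans (hB 0)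
  obtain ⟨x, hx0, hx⟩ := aux_global_exists
    (fun t (p : ℝ × ℝ) => ((p.2, 2 * ρ * p.2 - W t * p.1 + f t) : ℝ × ℝ)) (by fun_prop)
    (1 + 2 * |ρ| + M) B (by positivity) hB0 (aux_lip ρ W f M hM) (by
      intro t
      rw [Prod.norm_def]
      simp [hB t, hB0]) (a, b)
  have h1 : ∀ t, HasDerivAt (fun t => (x t).1) (x t).2 t := fun t => (hx t).fst
  have h2 : ∀ t, HasDerivAt (fun t => (x t).2) (2 * ρ * (x t).2 - W t * (x t).1 + f t) t :=
    fun t => (hx t).snd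
  have h3 : deriv (fun t => (x t).1) = fun t => (x t).2 := funext fun t => (h1 t).deriv
  refine ⟨fun t => (x t).1, ⟨fun t => (h1 t).differentiableAt, ?_⟩, ?_, ?_⟩
  · rw [h3]; exact h2
  · simp [hx0]
  · rw [h3]; simp [hx0]

theorem AuxSol.unique {ρ : ℝ} {W f y z : ℝ → ℝ} {M : ℝ}
    (hM : ∀ t, |W t| ≤ M) (hy : AuxSol ρ W f y) (hz : AuxSol ρ W f z) (h0 : y 0 = z 0)
    (h1 : deriv y 0 = deriv z 0) : y = z := by
  have hM0 : 0 ≤ M := (abs_nonneg _).trans (hM 0)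
  have key := ODE_solution_unique_univ
    (v := fun t (p : ℝ × ℝ) => ((p.2, 2 * ρ * p.2 - W t * p.1 + f t) : ℝ × ℝ))
    (s := fun _ => Set.univ) (K := Real.toNNReal (1 + 2 * |ρ| + M)) (t₀ := 0)
    (f := fun t => (y t, deriv y t)) (g := fun t => (z t, deriv z t))
    (fun t => by
      apply LipschitzWith.lipschitzOnWith
      apply LipschitzWith.of_dist_le_mul
      intro p q
      rw [Real.coe_toNNReal _ (by positivity), dist_eq_norm, dist_eq_norm]
      exact aux_lip ρ W f M hM t p q)
    (fun t => ⟨(hy.1 t).hasDerivAt.prodMk (hy.2 t), trivial⟩)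
    (fun t => ⟨(hz.1 t).hasDerivAt.prodMk (hz.2 t), trivial⟩)
    (by simp [h0, h1])
  funext t
  exact congrArg Prod.fst (congrFun key t)

theorem AuxSol.smooth {ρ : ℝ} {W f y : ℝ → ℝ} (hW : ContDiff ℝ (⊤ : ℕ∞) W)
    (hf : ContDiff ℝ (⊤ : ℕ∞) f) (hy : AuxSol ρ W f y) : ContDiff ℝ (⊤ : ℕ∞) y := by
  have hd : Differentiable ℝ (deriv y) := fun t => (hy.2 t).differentiableAt
  have e : deriv (deriv y) = fun t => 2 * ρ * deriv y t - W t * y t + f t :=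
    funext fun t => (hy.2 t).deriv
  have key : ∀ k : ℕ, ContDiff ℝ k y ∧ ContDiff ℝ k (deriv y) := by
    intro k
    induction k with
    | zero =>
      exact ⟨contDiff_zero.2 hy.1.continuous, contDiff_zero.2 hd.continuous⟩
    | succ k ih =>
      have hW' : ContDiff ℝ k W := hW.of_le (by exact_mod_cast le_top)
      have hf' : ContDiff ℝ k f := hf.of_le (by exact_mod_cast le_top)
      have i1 := ih.1
      have i2 := ih.2
      push_cast
      refine ⟨contDiff_succ_iff_deriv.2 ⟨hy.1, by simp, ih.2⟩,
        contDiff_succ_iff_deriv.2 ⟨hd, by simp, ?_⟩⟩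
      rw [e]
      fun_prop
  exact contDiff_infty.2 fun k => (key k).1

theorem aux_wronskian {ρ : ℝ} {W y z : ℝ → ℝ} (hy : AuxSol ρ W (fun _ => 0) y)
    (hz : AuxSol ρ W (fun _ => 0) z) (t : ℝ) :
    y t * deriv z t - deriv y t * z t
      = (y 0 * deriv z 0 - deriv y 0 * z 0) * Real.exp (2 * ρ * t) := by
  have hd : ∀ t, HasDerivAt (fun t => (y t * deriv z t - deriv y t * z t) * Real.exp (-(2 * ρ * t)))
      0 t := by
    intro t
    have h1 := (((hy.1 t).hasDerivAt.mul (hz.2 t)).sub ((hy.2 t).mul (hz.1 t).hasDerivAt)).mul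
      (((hasDerivAt_id t).const_mul (2 * ρ)).neg.exp)
    refine h1.congr_deriv ?_
    simp
    ring
  have hc := is_const_of_deriv_eq_zero (fun t => (hd t).differentiableAt) (fun t => (hd t).deriv) t 0
  simp only [mul_zero, neg_zero, Real.exp_zero, mul_one] at hc
  rw [← hc, mul_assoc, ← Real.exp_add]
  simp

theorem aux_alg (p q r s g0 g1 : ℝ) (D : ℝ) (hD : D ≠ 1) (hdet : p * s - q * r = D) :
    ∃ a b : ℝ,
      let h0 := g0 - ((p - 1) * a + q * b)
      let h1 := g1 - (r * a + (s - 1) * b)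
      (p - 1) * h0 + q * h1 = 0 ∧ r * h0 + (s - 1) * h1 = 0 := by
  by_cases h : (p - 1) * (s - 1) - q * r = 0
  · have hD' : D - 1 ≠ 0 := sub_ne_zero.2 hD
    have htr : p + s - 2 = D - 1 := by linarith
    refine ⟨g0 / (D - 1), g1 / (D - 1), ?_, ?_⟩
    · field_simp
      rw [← htr]
      linear_combination g0 * h
    · field_simp
      rw [← htr]
      linear_combination g1 * h
  · obtain ⟨i, hi⟩ : ∃ i, ((p - 1) * (s - 1) - q * r) * i = 1 := ⟨_, mul_inv_cancel₀ h⟩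
    refine ⟨((s - 1) * g0 - q * g1) * i, ((p - 1) * g1 - r * g0) * i, ?_, ?_⟩
    · linear_combination -((p - 1) * g0 + q * g1) * hi
    · linear_combination -(r * g0 + (s - 1) * g1) * hi

theorem aux_base {ρ T : ℝ} (hρ : 0 < ρ) (hT : 0 < T) {W f : ℝ → ℝ} (hW : ContDiff ℝ (⊤ : ℕ∞) W)
    (hWp : Function.Periodic W T)
    (hf : ContDiff ℝ (⊤ : ℕ∞) f) (hfp : Function.Periodic f T) :
    ∃ u v : ℝ → ℝ, ContDiff ℝ (⊤ : ℕ∞) u ∧ Function.Periodic u T ∧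
      ContDiff ℝ (⊤ : ℕ∞) v ∧ Function.Periodic v T ∧ AuxSol ρ W (fun _ => 0) v ∧
      AuxSol ρ W f (fun t => u t + t * v t) := by
  obtain ⟨M, hM⟩ := (hWp.isBounded_of_continuous hT.ne' hW.continuous).exists_norm_le
  obtain ⟨B, hB⟩ := (hfp.isBounded_of_continuous hT.ne' hf.continuous).exists_norm_le
  replace hM : ∀ t, |W t| ≤ M := fun t => hM _ ⟨t, rfl⟩
  replace hB : ∀ t, |f t| ≤ B := fun t => hB _ ⟨t, rfl⟩
  have hz : ∀ t : ℝ, |(fun _ => 0 : ℝ → ℝ) t| ≤ 0 := by simp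
  have hzp : Function.Periodic (fun _ => 0 : ℝ → ℝ) T := fun _ => rfl
  obtain ⟨y1, s1, a1, b1⟩ := AuxSol.exists (ρ := ρ) hW.continuous continuous_const hM hz 1 0
  obtain ⟨y2, s2, a2, b2⟩ := AuxSol.exists (ρ := ρ) hW.continuous continuous_const hM hz 0 1
  obtain ⟨Y, sY, -, -⟩ := AuxSol.exists (ρ := ρ) hW.continuous hf.continuous hM hB 0 0
  have hdet := aux_wronskian s1 s2 T
  rw [a1, b1, a2, b2] at hdet
  have hD : Real.exp (2 * ρ * T) ≠ 1 := by
    have : 1 < Real.exp (2 * ρ * T) := Real.one_lt_exp_iff.2 (by positivity)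
    exact this.ne'
  obtain ⟨a, b, e0, e1⟩ := aux_alg (y1 T) (y2 T) (deriv y1 T) (deriv y2 T) (Y T - Y 0)
    (deriv Y T - deriv Y 0) _ hD (by linarith)
  -- any homogeneous solution `h` with zero shifted difference in coordinates is periodic
  have hper : ∀ h, AuxSol ρ W (fun _ => 0) h →
      (y1 T - 1) * h 0 + y2 T * deriv h 0 = 0 →
      deriv y1 T * h 0 + (deriv y2 T - 1) * deriv h 0 = 0 → Function.Periodic h T := by
    intro h hh c0 c1
    obtain ⟨k1, k2⟩ := s1.comb s2 (h 0) (deriv h 0)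
    simp only [mul_zero, add_zero] at k1
    have eq := hh.unique hM k1 (by simp [a1, a2]) (by rw [k2]; simp [b1, b2])
    obtain ⟨l1, l2⟩ := hh.shift hWp hzp
    have hT0 : h T = h 0 * y1 T + deriv h 0 * y2 T := congrFun eq T
    have hT1 : deriv h T = h 0 * deriv y1 T + deriv h 0 * deriv y2 T := by
      rw [← k2, ← eq]
    have := l1.unique hM hh (by simp only [zero_add]; linarith)
      (by rw [l2]; simp only [zero_add]; linarith)
    exact fun t => congrFun this t
  -- the corrected solution
  obtain ⟨k1, k2⟩ := s1.comb s2 a b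
  obtain ⟨m1, m2⟩ := sY.comb k1 1 (-1)
  simp only [mul_zero, add_zero, one_mul] at m1
  set η : ℝ → ℝ := fun t => 1 * Y t + -1 * (a * y1 t + b * y2 t) with hη
  have m1' : AuxSol ρ W f η := by simpa [hη] using m1
  have dη : ∀ t, deriv η t = deriv Y t - (a * deriv y1 t + b * deriv y2 t) := by
    intro t; rw [m2, k2]; ring
  obtain ⟨n1, n2⟩ := m1'.shift hWp hfp
  obtain ⟨q1, q2⟩ := n1.comb m1' (1 / T) (-(1 / T))
  set v : ℝ → ℝ := fun t => 1 / T * η (t + T) + -(1 / T) * η t with hv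
  have q1' : AuxSol ρ W (fun _ => 0) v := by
    convert q1 using 2
    ring
  have vp : Function.Periodic v T := by
    apply hper v q1'
    · rw [q2, n2, dη, dη]
      simp only [hv, hη, zero_add, a1, a2, b1, b2]
      linear_combination (1 / T) * e0
    · rw [q2, n2, dη, dη]
      simp only [hv, hη, zero_add, a1, a2, b1, b2]
      linear_combination (1 / T) * e1
  have hvs := q1'.smooth hW contDiff_const
  have hηs := m1'.smooth hW hf
  refine ⟨fun t => η t - t * v t, v, by fun_prop, ?_, hvs, vp, q1', by simpa using m1'⟩
  intro t
  change η (t + T) - (t + T) * v (t + T) = η t - t * v t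
  rw [vp t]
  have : T * v t = η (t + T) - η t := by simp only [hv]; field_simp; ring
  linear_combination -this

def AuxPoly (T : ℝ) (J : ℕ) (F : ℝ → ℝ) : Prop :=
  ∃ c : ℕ → ℝ → ℝ, (∀ j, ContDiff ℝ (⊤ : ℕ∞) (c j) ∧ Function.Periodic (c j) T) ∧
    ∀ t, F t = ∑ j ∈ Finset.range J, c j t * t ^ j

theorem AuxPoly.comb {T : ℝ} {J : ℕ} {F G : ℝ → ℝ} (hF : AuxPoly T J F) (hG : AuxPoly T J G)
    (a b : ℝ) : AuxPoly T J (fun t => a * F t + b * G t) := by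
  obtain ⟨c, hc, ec⟩ := hF
  obtain ⟨e, he, ee⟩ := hG
  refine ⟨fun j t => a * c j t + b * e j t, fun j => ⟨?_, ?_⟩, fun t => ?_⟩
  · have := (hc j).1
    have := (he j).1
    fun_prop
  · intro t
    change a * c j (t + T) + b * e j (t + T) = _
    rw [(hc j).2 t, (he j).2 t]
  · change a * F t + b * G t = _
    rw [ec, ee, Finset.mul_sum, Finset.mul_sum, ← Finset.sum_add_distrib]
    exact Finset.sum_congr rfl fun j _ => by ring

theorem AuxPoly.mono {T : ℝ} {J K : ℕ} (h : J ≤ K) {F : ℝ → ℝ} (hF : AuxPoly T J F) :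
    AuxPoly T K F := by
  obtain ⟨c, hc, ec⟩ := hF
  refine ⟨fun j => if j < J then c j else fun _ => 0, fun j => ?_, fun t => ?_⟩
  · by_cases hj : j < J
    · simp only [hj, if_true]; exact hc j
    · simp only [hj, if_false]; exact ⟨contDiff_const, fun _ => rfl⟩
  · rw [ec, ← Finset.sum_subset (Finset.range_mono h)]
    · exact Finset.sum_congr rfl fun j hj => by simp [Finset.mem_range.1 hj]
    · intro j _ hj
      simp [Finset.mem_range] at hj
      simp [not_lt.2 hj]

theorem AuxPoly.monomial {T : ℝ} {J k : ℕ} (hk : k < J) {u : ℝ → ℝ} (hu : ContDiff ℝ (⊤ : ℕ∞) u)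
    (hup : Function.Periodic u T) : AuxPoly T J (fun t => u t * t ^ k) := by
  refine ⟨fun j => if j = k then u else fun _ => 0, fun j => ?_, fun t => ?_⟩
  · by_cases hj : j = k
    · simp only [hj, if_true]; exact ⟨hu, hup⟩
    · simp only [hj, if_false]; exact ⟨contDiff_const, fun _ => rfl⟩
  · rw [Finset.sum_eq_single k]
    · simp
    · intro j _ hj; simp [hj]
    · intro h; exact absurd (Finset.mem_range.2 hk) h

theorem AuxPoly.zero (T : ℝ) (J : ℕ) : AuxPoly T J (fun _ => 0) :=
  ⟨fun _ _ => 0, fun _ => ⟨contDiff_const, fun _ => rfl⟩, fun t => by simp⟩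

theorem aux_step {ρ : ℝ} {W f u v : ℝ → ℝ} (hu : ContDiff ℝ (⊤ : ℕ∞) u)
    (hv : AuxSol ρ W (fun _ => 0) v)
    (hz : AuxSol ρ W f (fun t => u t + t * v t)) (J : ℕ) :
    AuxSol ρ W (fun t => f t * t ^ J + ((J * (2 * deriv u t - 2 * ρ * u t + v t)) * t ^ (J - 1)
      + (J * ((J - 1 : ℕ) : ℝ) * u t) * t ^ (J - 1 - 1)))
      (fun t => u t * t ^ J + (1 / ((J : ℝ) + 1) * v t) * t ^ (J + 1)) := by
  have hud : Differentiable ℝ u := hu.differentiable (by simp)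
  have hud2 : Differentiable ℝ (deriv u) :=
    (contDiff_infty_iff_deriv.1 hu).2.differentiable (by simp)
  have hJ : (J : ℝ) + 1 ≠ 0 := by positivity
  have z1 : ∀ t, HasDerivAt (fun t => u t + t * v t) (deriv u t + (1 * v t + t * deriv v t)) t :=
    fun t => (hud t).hasDerivAt.add ((hasDerivAt_id t).mul (hv.1 t).hasDerivAt)
  have z1' : deriv (fun t => u t + t * v t) = fun t => deriv u t + (1 * v t + t * deriv v t) :=
    funext fun t => (z1 t).deriv
  have hu2 : ∀ t, deriv (deriv u) t
      = 2 * ρ * deriv u t + 2 * ρ * v t - W t * u t + f t - 2 * deriv v t := by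
    intro t
    have h1 := hz.2 t
    have h2 := (hud2 t).hasDerivAt.add (((hv.1 t).hasDerivAt.const_mul 1).add
      ((hasDerivAt_id t).mul (hv.2 t)))
    rw [z1'] at h1
    have h3 := h1.unique h2
    simp only [id] at h3
    linear_combination -h3
  have w1 : ∀ t, HasDerivAt (fun t => u t * t ^ J + (1 / ((J : ℝ) + 1) * v t) * t ^ (J + 1))
      (deriv u t * t ^ J + J * u t * t ^ (J - 1) + 1 / ((J : ℝ) + 1) * deriv v t * t ^ (J + 1)
        + v t * t ^ J) t := by
    intro t
    have h := ((hud t).hasDerivAt.mul (hasDerivAt_pow J t)).add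
      (((hv.1 t).hasDerivAt.const_mul (1 / ((J : ℝ) + 1))).mul (hasDerivAt_pow (J + 1) t))
    refine h.congr_deriv ?_
    push_cast
    field_simp
    ring
  have w1' := funext fun t => (w1 t).deriv
  refine ⟨fun t => (w1 t).differentiableAt, fun t => ?_⟩
  rw [w1']
  have h := ((((hud2 t).hasDerivAt.mul (hasDerivAt_pow J t)).add
      (((hud t).hasDerivAt.const_mul (J : ℝ)).mul (hasDerivAt_pow (J - 1) t))).add
      (((hv.2 t).const_mul (1 / ((J : ℝ) + 1))).mul (hasDerivAt_pow (J + 1) t))).add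
      ((hv.1 t).hasDerivAt.mul (hasDerivAt_pow J t))
  refine h.congr_deriv ?_
  rw [hu2 t]
  push_cast
  field_simp
  ring

theorem aux_periodic_deriv {u : ℝ → ℝ} {T : ℝ} (hu : Function.Periodic u T) :
    Function.Periodic (deriv u) T := by
  intro t
  rw [← deriv_comp_add_const]
  congr 1
  exact funext hu

theorem aux_main {ρ T : ℝ} (hρ : 0 < ρ) (hT : 0 < T) {W : ℝ → ℝ} (hW : ContDiff ℝ (⊤ : ℕ∞) W)
    (hWp : Function.Periodic W T) (J : ℕ) : ∀ F, AuxPoly T J F →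
      ∃ G, AuxPoly T (J + 1) G ∧ AuxSol ρ W F G := by
  induction J with
  | zero =>
    rintro F ⟨c, hc, ec⟩
    refine ⟨fun _ => 0, AuxPoly.zero _ _, ?_⟩
    have : F = fun _ => 0 := by funext t; simp [ec]
    subst this
    refine ⟨differentiable_const _, fun t => ?_⟩
    simpa using hasDerivAt_const t (0 : ℝ)
  | succ J ih =>
    rintro F ⟨c, hc, ec⟩
    have hF0 : AuxPoly T J (fun t => ∑ j ∈ Finset.range J, c j t * t ^ j) := ⟨c, hc, fun _ => rfl⟩
    obtain ⟨u, v, hu, hup, hv, hvp, sv, sz⟩ := aux_base hρ hT hW hWp (hc J).1 (hc J).2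
    have sw := aux_step hu sv sz J
    have hdu : ContDiff ℝ (⊤ : ℕ∞) (deriv u) := (contDiff_infty_iff_deriv.1 hu).2
    have hdup := aux_periodic_deriv hup
    have hR : AuxPoly T J (fun t => (J * (2 * deriv u t - 2 * ρ * u t + v t)) * t ^ (J - 1)
      + (J * ((J - 1 : ℕ) : ℝ) * u t) * t ^ (J - 1 - 1)) := by
      rcases Nat.eq_zero_or_pos J with h0 | h0
      · subst h0
        simpa using AuxPoly.zero T 0
      · have r1 := AuxPoly.monomial (T := T) (J := J) (k := J - 1) (by omega)
          (u := fun t => J * (2 * deriv u t - 2 * ρ * u t + v t)) (by fun_prop)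
          (fun t => by simp only [hup t, hvp t, hdup t])
        have r2 := AuxPoly.monomial (T := T) (J := J) (k := J - 1 - 1) (by omega)
          (u := fun t => J * ((J - 1 : ℕ) : ℝ) * u t) (by fun_prop)
          (fun t => by simp only [hup t])
        simpa using r1.comb r2 1 1
    obtain ⟨G0, hG0, sG0⟩ := ih _ (hF0.comb hR 1 (-1))
    have m1 := AuxPoly.monomial (T := T) (J := J + 1 + 1) (k := J) (by omega) hu hup
    have m2 := AuxPoly.monomial (T := T) (J := J + 1 + 1) (k := J + 1) (by omega)
      (u := fun t => 1 / ((J : ℝ) + 1) * v t) (by fun_prop) (fun t => by simp only [hvp t])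
    have m3 := m1.comb m2 1 1
    have m4 := (hG0.mono (Nat.le_succ (J + 1))).comb m3 1 1
    refine ⟨_, m4, ?_⟩
    have s := (sG0.comb sw 1 1).1
    convert s using 2 with t t
    · rw [ec, Finset.sum_range_succ]
      ring
    · ring

/-- Resonant periodic solvability: for a right-hand side which is a polynomial
in `t` of degree `J` with `T`-periodic coefficients times `e^{−ρ_d t}`, the
equation `L_{ψ,d} η = (Σ_j a_j(t) t^j) e^{−ρ_d t}` has a solution of the same
form with one more power of `t`. -/
theorem periodic_solvability_resonant
    (n : ℕ) (hn : 3 ≤ n) (ψ : ℝ → ℝ) (T : ℝ) (hψ : IsStdRadial n ψ T)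
    (d : ℕ) (hd : 1 ≤ d) (ρ : ℝ) (hρ : IsIndicialRoot n ψ T d ρ) (J : ℕ) :
    ∀ a : ℕ → ℝ → ℝ, (∀ j ≤ J, ContDiff ℝ (⊤ : ℕ∞) (a j) ∧ Function.Periodic (a j) T) →
      ∃ c : ℕ → ℝ → ℝ, (∀ j ≤ J + 1, ContDiff ℝ (⊤ : ℕ∞) (c j) ∧ Function.Periodic (c j) T) ∧
        ∀ t : ℝ,
          odeOp n ψ d
            (fun s => (∑ j ∈ Finset.range (J + 2), c j s * s ^ j) * Real.exp (-ρ * s)) t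
          = (∑ j ∈ Finset.range (J + 1), a j t * t ^ j) * Real.exp (-ρ * t) := by
  intro a ha
  obtain ⟨hψs, hT, hψp, hψb, -⟩ := hψ
  have hF : AuxPoly T (J + 1) (fun t => ∑ j ∈ Finset.range (J + 1), a j t * t ^ j) := by
    refine ⟨fun j => if j ≤ J then a j else fun _ => 0, fun j => ?_, fun t => ?_⟩
    · by_cases hj : j ≤ J
      · simp only [hj, if_true]; exact ha j hj
      · simp only [hj, if_false]; exact ⟨contDiff_const, fun _ => rfl⟩
    · exact Finset.sum_congr rfl fun j hj => by
        simp [Nat.lt_succ_iff.1 (Finset.mem_range.1 hj)]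
  have hpow : ContDiff ℝ (⊤ : ℕ∞) (fun t => ψ t ^ ((4 : ℝ) / ((n : ℝ) - 2))) :=
    hψs.rpow_const_of_ne (fun t => (hψb t).1.ne')
  obtain ⟨G, ⟨c, hc, ec⟩, sG⟩ := aux_main hρ.1 hT
    (W := fun t => ρ ^ 2 + (((n : ℝ) * ((n : ℝ) + 2)) / 4 * ψ t ^ ((4 : ℝ) / ((n : ℝ) - 2))
        - ((n : ℝ) - 2) ^ 2 / 4 - (d : ℝ) * ((d : ℝ) + (n : ℝ) - 2)))
    (by fun_prop) (fun t => by simp only [hψp t]) (J + 1) _ hF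
  refine ⟨c, fun j _ => hc j, fun t => ?_⟩
  have e : (fun s => (∑ j ∈ Finset.range (J + 2), c j s * s ^ j) * Real.exp (-ρ * s))
      = fun s => G s * Real.exp (-ρ * s) := by funext s; rw [ec]
  rw [e]
  have he : ∀ s, HasDerivAt (fun s => Real.exp (-ρ * s)) (Real.exp (-ρ * s) * (-ρ)) s := by
    intro s
    simpa using ((hasDerivAt_id s).const_mul (-ρ)).exp
  have d1 : deriv (fun s => G s * Real.exp (-ρ * s))
      = fun s => deriv G s * Real.exp (-ρ * s) + G s * (Real.exp (-ρ * s) * (-ρ)) :=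
    funext fun s => ((sG.1 s).hasDerivAt.mul (he s)).deriv
  have d2 := (((sG.2 t).mul (he t)).add ((sG.1 t).hasDerivAt.mul ((he t).mul_const (-ρ)))).deriv
  unfold odeOp
  rw [d1]
  refine (congrArg (· + _) d2).trans ?_
  ring
end
end
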